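/- Let α ∈ (ℤ≥0)^m and β ∈ (ℤ≥0)^n with |α| = |β| = K > 1, let A ∈ M̂_{m×n}(α,β), and let A^perm be the unique (α,β)-descending extended affine permutation B ∈ W̃_{K,(α,β)} with Σ_{(k,l)∈𝓘_i×𝓙_j} b_{kl} = a_{ij} for all (i,j). If κ₀(A) = (P₀, Q₀, ρ), then κ₀(A^perm) = (P₀^st, Q₀^st, ρ), where for a column-semistandard tableau T of content γ (γ_k the number of entries of T equal to k), T^st is obtained by replacing, for each k, the occurrences of k in T, taken from left to right, by the consecutive integers γ₁+⋯+γ_{k−1}+1, γ₁+⋯+γ_{k−1}+2, …, γ₁+⋯+γ_k. -/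

import Mathlib

open scoped Classical

namespace AffineRSK

/-- `ℤ × ℤ`-matrices with non-negative integer entries. -/
abbrev Mat : Type := ℤ → ℤ → ℕ

abbrev Cell : Type := ℤ × ℤ

/-- Generalized affine permutations of period `(m, n)`:
`a_{i+m, j+n} = a_{ij}` and each column has finite support. -/
def IsGAP (m n : ℕ) (A : Mat) : Prop :=
  (∀ i j : ℤ, A (i + m) (j + n) = A i j) ∧ ∀ j : ℤ, {i : ℤ | A i j ≠ 0}.Finite

/-- Generalized dual affine permutations: entries in `{0, 1}`. -/
def IsGDAP (m n : ℕ) (A : Mat) : Prop :=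
  IsGAP m n A ∧ ∀ i j : ℤ, A i j ≤ 1

def supp (A : Mat) : Set Cell := {c : Cell | A c.1 c.2 ≠ 0}

def tauC (m n : ℕ) (c : Cell) : Cell := (c.1 + (m : ℤ), c.2 + (n : ℤ))

/-- `NW c₁ c₂` means `c₁ >_NW c₂`. -/
def NW (c₁ c₂ : Cell) : Prop := c₁.1 < c₂.1 ∧ c₁.2 < c₂.2

/-- `nwGe c₁ c₂` means `c₁ ≥_nw c₂`. -/
def nwGe (c₁ c₂ : Cell) : Prop := c₁.1 ≤ c₂.1 ∧ c₁.2 ≤ c₂.2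

/-- `neLe c₁ c₂` means `c₁ ≤_ne c₂`. -/
def neLe (c₁ c₂ : Cell) : Prop := c₂.1 ≤ c₁.1 ∧ c₁.2 ≤ c₂.2

/-- `nWgt c₁ c₂` means `c₁ >_nW c₂` (dual order). -/
def nWgt (c₁ c₂ : Cell) : Prop := c₁.1 ≤ c₂.1 ∧ c₁.2 < c₂.2

/-- `NeLt c₁ c₂` means `c₁ <_Ne c₂` (dual order). -/
def NeLt (c₁ c₂ : Cell) : Prop := c₂.1 < c₁.1 ∧ c₁.2 ≤ c₂.2

/-- A proper numbering on `A`. -/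
def IsProper (A : Mat) (d : Cell → ℤ) : Prop :=
  (∀ c₁ ∈ supp A, ∀ c₂ ∈ supp A, NW c₂ c₁ → d c₂ < d c₁) ∧
    ∀ c₁ ∈ supp A, ∃ c₂ ∈ supp A, NW c₂ c₁ ∧ d c₂ = d c₁ - 1

/-- A dual proper numbering on `A`. -/
def IsProper' (A : Mat) (d : Cell → ℤ) : Prop :=
  (∀ c₁ ∈ supp A, ∀ c₂ ∈ supp A, nWgt c₂ c₁ → d c₂ < d c₁) ∧
    ∀ c₁ ∈ supp A, ∃ c₂ ∈ supp A, nWgt c₂ c₁ ∧ d c₂ = d c₁ - 1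

/-- An enumeration of a stream of flow `l`. -/
def IsStreamEnum (m n : ℕ) (e : ℤ → Cell) (l : ℕ) : Prop :=
  0 < l ∧ (∀ i : ℤ, NW (e i) (e (i + 1))) ∧ ∀ i : ℤ, tauC m n (e i) = e (i + l)

def IsStreamEnum' (m n : ℕ) (e : ℤ → Cell) (l : ℕ) : Prop :=
  0 < l ∧ (∀ i : ℤ, nWgt (e i) (e (i + 1))) ∧ ∀ i : ℤ, tauC m n (e i) = e (i + l)

def IsStream (m n : ℕ) (S : Set Cell) (l : ℕ) : Prop :=
  ∃ e : ℤ → Cell, IsStreamEnum m n e l ∧ Set.range e = S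

def IsStream' (m n : ℕ) (S : Set Cell) (l : ℕ) : Prop :=
  ∃ e : ℤ → Cell, IsStreamEnum' m n e l ∧ Set.range e = S

/-- A channel of `A`: a stream contained in `supp A` of maximal flow. -/
def IsChannel (m n : ℕ) (A : Mat) (C : Set Cell) : Prop :=
  ∃ l : ℕ, IsStream m n C l ∧ C ⊆ supp A ∧
    ∀ (S : Set Cell) (l' : ℕ), IsStream m n S l' → S ⊆ supp A → l' ≤ l

def IsChannel' (m n : ℕ) (A : Mat) (C : Set Cell) : Prop :=
  ∃ l : ℕ, IsStream' m n C l ∧ C ⊆ supp A ∧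
    ∀ (S : Set Cell) (l' : ℕ), IsStream' m n S l' → S ⊆ supp A → l' ≤ l

def Csw (A : Mat) (C : Set Cell) : Set Cell :=
  {c ∈ supp A | ∃ c' ∈ C, neLe c c'}

def Csw' (A : Mat) (C : Set Cell) : Set Cell :=
  {c ∈ supp A | c ∈ C ∨ ∃ c' ∈ C, NeLt c c'}

/-- `swGe A C₁ C₂` means `C₁ ≽_sw C₂`. -/
def swGe (A : Mat) (C₁ C₂ : Set Cell) : Prop := C₁ ⊆ Csw A C₂

def swGe' (A : Mat) (C₁ C₂ : Set Cell) : Prop := C₁ ⊆ Csw' A C₂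

/-- The set of values `d₀(c'_k) + k` over `>_NW`-chains from `c` to the channel
enumerated by `e` (where `d₀ (e idx) = idx`). -/
def chainSet (A : Mat) (e : ℤ → Cell) (c : Cell) : Set ℤ :=
  {v : ℤ | ∃ (k : ℕ) (ch : ℕ → Cell),
      ch 0 = c ∧ (∀ i ≤ k, ch i ∈ supp A) ∧ (∀ i < k, NW (ch (i + 1)) (ch i)) ∧
        ∃ idx : ℤ, e idx = ch k ∧ v = idx + (k : ℤ)}

def chainSet' (A : Mat) (e : ℤ → Cell) (c : Cell) : Set ℤ :=
  {v : ℤ | ∃ (k : ℕ) (ch : ℕ → Cell),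
      ch 0 = c ∧ (∀ i ≤ k, ch i ∈ supp A) ∧ (∀ i < k, nWgt (ch (i + 1)) (ch i)) ∧
        ∃ idx : ℤ, e idx = ch k ∧ v = idx + (k : ℤ)}

/-- `d` is the channel numbering `d^C_A` for the channel enumerated by `e`. -/
def IsChannelNumbering (A : Mat) (e : ℤ → Cell) (d : Cell → ℤ) : Prop :=
  ∀ c ∈ supp A, IsGreatest (chainSet A e c) (d c)

def IsChannelNumbering' (A : Mat) (e : ℤ → Cell) (d : Cell → ℤ) : Prop :=
  ∀ c ∈ supp A, IsGreatest (chainSet' A e c) (d c)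

/-- `e` enumerates the southwest channel of `A`. -/
def IsSWChannelEnum (m n : ℕ) (A : Mat) (e : ℤ → Cell) : Prop :=
  (∃ l : ℕ, IsStreamEnum m n e l) ∧ IsChannel m n A (Set.range e) ∧
    ∀ C : Set Cell, IsChannel m n A C → swGe A (Set.range e) C

def IsSWChannelEnum' (m n : ℕ) (A : Mat) (e : ℤ → Cell) : Prop :=
  (∃ l : ℕ, IsStreamEnum' m n e l) ∧ IsChannel' m n A (Set.range e) ∧
    ∀ C : Set Cell, IsChannel' m n A C → swGe' A (Set.range e) C

/-- `d` is a southwest channel numbering of `A`. -/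
def IsSWNumbering (m n : ℕ) (A : Mat) (d : Cell → ℤ) : Prop :=
  ∃ e : ℤ → Cell, IsSWChannelEnum m n A e ∧ IsChannelNumbering A e d

def IsSWNumbering' (m n : ℕ) (A : Mat) (d : Cell → ℤ) : Prop :=
  ∃ e : ℤ → Cell, IsSWChannelEnum' m n A e ∧ IsChannelNumbering' A e d

/-- A zig-zag: bi-infinite east/north lattice path, eventually east on the
right and coming from the south on the left. -/
def IsZigZag (z : ℤ → Cell) : Prop :=
  (∀ i : ℤ, z (i + 1) = ((z i).1, (z i).2 + 1) ∨ z (i + 1) = ((z i).1 - 1, (z i).2)) ∧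
  (∃ N : ℤ, ∀ i : ℤ, N ≤ i → z (i + 1) = ((z i).1, (z i).2 + 1)) ∧
    ∃ N : ℤ, ∀ i : ℤ, i ≤ N → z (i + 1) = ((z i).1 - 1, (z i).2)

def innerCorners (z : ℤ → Cell) : Set Cell :=
  {c : Cell | ∃ i : ℤ, z i = c ∧ z i = ((z (i - 1)).1 - 1, (z (i - 1)).2) ∧
      z (i + 1) = ((z i).1, (z i).2 + 1)}

def outerCorners (z : ℤ → Cell) : Set Cell :=
  {c : Cell | ∃ i : ℤ, z i = c ∧ z i = ((z (i - 1)).1, (z (i - 1)).2 + 1) ∧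
      z (i + 1) = ((z i).1 - 1, (z i).2)}

def levelSet (A : Mat) (d : Cell → ℤ) (k : ℤ) : Set Cell := {c ∈ supp A | d c = k}

/-- `≥_nw`-maximal cells of `S`. -/
def nwMaximal (S : Set Cell) : Set Cell := {c ∈ S | ∀ c' ∈ S, nwGe c' c → c' = c}

/-- `>_nW`-maximal cells of `S` (dual). -/
def nWMaximal (S : Set Cell) : Set Cell := {c ∈ S | ∀ c' ∈ S, ¬ nWgt c' c}

/-- `z` is the zig-zag at level `k` associated to the numbering `d`. -/
def ZigZagAt (A : Mat) (d : Cell → ℤ) (k : ℤ) (z : ℤ → Cell) : Prop :=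
  IsZigZag z ∧ innerCorners z = nwMaximal (levelSet A d k)

def ZigZagAt' (A : Mat) (d : Cell → ℤ) (k : ℤ) (z : ℤ → Cell) : Prop :=
  IsZigZag z ∧ innerCorners z = nWMaximal (levelSet A d k)

def IsInnerOf (A : Mat) (d : Cell → ℤ) (c : Cell) : Prop :=
  ∃ (k : ℤ) (z : ℤ → Cell), ZigZagAt A d k z ∧ c ∈ innerCorners z

def IsOuterOf (A : Mat) (d : Cell → ℤ) (c : Cell) : Prop :=
  ∃ (k : ℤ) (z : ℤ → Cell), ZigZagAt A d k z ∧ c ∈ outerCorners z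

def IsInnerOf' (A : Mat) (d : Cell → ℤ) (c : Cell) : Prop :=
  ∃ (k : ℤ) (z : ℤ → Cell), ZigZagAt' A d k z ∧ c ∈ innerCorners z

def IsOuterOf' (A : Mat) (d : Cell → ℤ) (c : Cell) : Prop :=
  ∃ (k : ℤ) (z : ℤ → Cell), ZigZagAt' A d k z ∧ c ∈ outerCorners z

/-- `B` is obtained from `A` by subtracting `1` at inner corners and adding `1`
at outer corners. -/
def FlatEntries (A B : Mat) (Inn Out : Cell → Prop) : Prop :=
  ∀ c : Cell,
    (Inn c → B c.1 c.2 + 1 = A c.1 c.2) ∧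
    (Out c → B c.1 c.2 = A c.1 c.2 + 1) ∧
    (¬ Inn c → ¬ Out c → B c.1 c.2 = A c.1 c.2)

/-- `B = A^♭`. -/
def FlatRel (m n : ℕ) (A B : Mat) : Prop :=
  ∃ d : Cell → ℤ, IsSWNumbering m n A d ∧
    FlatEntries A B (IsInnerOf A d) (IsOuterOf A d)

/-- `B = A^{♭'}` (dual). -/
def FlatRel' (m n : ℕ) (A B : Mat) : Prop :=
  ∃ d : Cell → ℤ, IsSWNumbering' m n A d ∧
    FlatEntries A B (IsInnerOf' A d) (IsOuterOf' A d)

/-- `c` is the back-post corner of the zig-zag `z`: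
`(row of rightmost inner corner, column of leftmost inner corner)`. -/
def IsBackPost (z : ℤ → Cell) (c : Cell) : Prop :=
  ∃ cr ∈ innerCorners z, ∃ cl ∈ innerCorners z,
    (∀ c' ∈ innerCorners z, c'.2 ≤ cr.2) ∧ (∀ c' ∈ innerCorners z, cl.2 ≤ c'.2) ∧
      c = (cr.1, cl.2)

def backPostSet (A : Mat) (d : Cell → ℤ) : Set Cell :=
  {c : Cell | ∃ (k : ℤ) (z : ℤ → Cell), ZigZagAt A d k z ∧ IsBackPost z c}

def backPostSet' (A : Mat) (d : Cell → ℤ) : Set Cell :=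
  {c : Cell | ∃ (k : ℤ) (z : ℤ → Cell), ZigZagAt' A d k z ∧ IsBackPost z c}

/-- Defining data `(a, b, r)` of the stream enumerated by `e` of flow `l`. -/
def StreamData (m n : ℕ) (e : ℤ → Cell) (l : ℕ) (a b : ℕ → ℤ) (r : ℤ) : Prop :=
  ∃ r₁ r₂ : ℤ,
    (∀ p : ℕ, p < l → a p = (e (r₁ + 1 + p)).1 ∧ 1 ≤ a p ∧ a p ≤ (m : ℤ)) ∧
    (∀ p : ℕ, p < l → b p = (e (r₂ + 1 + p)).2 ∧ 1 ≤ b p ∧ b p ≤ (n : ℤ)) ∧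
      r = r₁ - r₂

/-- The matrix-ball iteration `A = A^(0), A^(t) = (A^(t-1))^♭`, with
`A^(t) ≠ O` for `t < s` and `A^(s) = O`. -/
def MBCseq (m n : ℕ) (A : Mat) (s : ℕ) (Aseq : ℕ → Mat) : Prop :=
  Aseq 0 = A ∧ (∀ t < s, Aseq t ≠ 0) ∧ Aseq s = 0 ∧
    ∀ t < s, FlatRel m n (Aseq t) (Aseq (t + 1))

def MBCseq' (m n : ℕ) (A : Mat) (s : ℕ) (Aseq : ℕ → Mat) : Prop :=
  Aseq 0 = A ∧ (∀ t < s, Aseq t ≠ 0) ∧ Aseq s = 0 ∧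
    ∀ t < s, FlatRel' m n (Aseq t) (Aseq (t + 1))

/-- `κ₀(A) = (P, Q, ρ)`, with shape given by the column lengths `μ`:
the `t`-th columns (from the left, `0`-based) of `P` and `Q` are the defining
data of the stream of back-post corners of the zig-zags of `d^{sw}_{A^(t)}`. -/
def Kappa0Rel (m n : ℕ) (A : Mat) (s : ℕ) (μ : ℕ → ℕ) (P Q : ℕ → ℕ → ℤ)
    (ρ : ℕ → ℤ) : Prop :=
  ∃ Aseq : ℕ → Mat, MBCseq m n A s Aseq ∧
    ∀ t < s, ∃ (d : Cell → ℤ) (e : ℤ → Cell),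
      IsSWNumbering m n (Aseq t) d ∧ IsStreamEnum m n e (μ t) ∧
        Set.range e = backPostSet (Aseq t) d ∧
        StreamData m n e (μ t) (fun x => P x t) (fun x => Q x t) (ρ t)

def Kappa0Rel' (m n : ℕ) (A : Mat) (s : ℕ) (μ : ℕ → ℕ) (P Q : ℕ → ℕ → ℤ)
    (ρ : ℕ → ℤ) : Prop :=
  ∃ Aseq : ℕ → Mat, MBCseq' m n A s Aseq ∧
    ∀ t < s, ∃ (d : Cell → ℤ) (e : ℤ → Cell),
      IsSWNumbering' m n (Aseq t) d ∧ IsStreamEnum' m n e (μ t) ∧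
        Set.range e = backPostSet' (Aseq t) d ∧
        StreamData m n e (μ t) (fun x => P x t) (fun x => Q x t) (ρ t)

/-! ### Columns and the shift `τ` -/

/-- Extension of a column `c` of length `b` to `ℤ`: `c̃(x + bq) = c(x) + nq`. -/
def colExt (n b : ℕ) (c : ℕ → ℤ) (z : ℤ) : ℤ :=
  c (Int.toNat (Int.emod z (b : ℤ))) + (n : ℤ) * Int.ediv z (b : ℤ)

/-- `τ_n^k` applied to a column of length `b`. -/
def tauPow (n b : ℕ) (k : ℤ) (c : ℕ → ℤ) : ℕ → ℤ :=
  fun x => colExt n b c ((x : ℤ) + k)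

/-- The two-column tableau `(column t of T, τ_N^r(column (t+1) of T))`
(both of height `μ t`) is `ℤ`-semistandard. -/
def pairCond (N : ℕ) (μ : ℕ → ℕ) (T : ℕ → ℕ → ℤ) (t : ℕ) (r : ℕ) : Prop :=
  (∀ x : ℕ, x + 1 < μ t → T x t < T (x + 1) t) ∧
  (∀ x : ℕ, x + 1 < μ t →
    tauPow N (μ t) (r : ℤ) (fun y => T y (t + 1)) x <
      tauPow N (μ t) (r : ℤ) (fun y => T y (t + 1)) (x + 1)) ∧
    ∀ x < μ t, T x t ≤ tauPow N (μ t) (r : ℤ) (fun y => T y (t + 1)) x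

/-- The offset `r` for the adjacent pair of columns `(t, t+1)`. -/
noncomputable def rOff (N : ℕ) (μ : ℕ → ℕ) (T : ℕ → ℕ → ℤ) (t : ℕ) : ℕ :=
  sInf {r : ℕ | pairCond N μ T t r}

/-- Dual version: placing row `t` above row `τ_N^r(row (t+1))` (rows of the
transposed tableau, i.e. columns of `T`) is `ℤ`-semistandard. -/
def dualPairCond (N : ℕ) (μ : ℕ → ℕ) (T : ℕ → ℕ → ℤ) (t : ℕ) (r : ℕ) : Prop :=
  (∀ x : ℕ, x + 1 < μ t → T x t ≤ T (x + 1) t) ∧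
  (∀ x : ℕ, x + 1 < μ t →
    tauPow N (μ t) (r : ℤ) (fun y => T y (t + 1)) x ≤
      tauPow N (μ t) (r : ℤ) (fun y => T y (t + 1)) (x + 1)) ∧
    ∀ x < μ t, T x t < tauPow N (μ t) (r : ℤ) (fun y => T y (t + 1)) x

noncomputable def rOffDual (N : ℕ) (μ : ℕ → ℕ) (T : ℕ → ℕ → ℤ) (t : ℕ) : ℕ :=
  sInf {r : ℕ | dualPairCond N μ T t r}

/-- First column of the rectangle block containing column `t`. -/
noncomputable def blockStart (μ : ℕ → ℕ) (t : ℕ) : ℕ := sInf {t' : ℕ | μ t' = μ t}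

/-- The symmetrized offset entry attached to column `t`
(`η_j` where `j` is the position of `t` from the right in its block). -/
noncomputable def etaCol (N : ℕ) (μ : ℕ → ℕ) (T : ℕ → ℕ → ℤ) (t : ℕ) : ℕ :=
  ∑ u ∈ Finset.Ico (blockStart μ t) t, rOff N μ T u

noncomputable def etaColDual (N : ℕ) (μ : ℕ → ℕ) (T : ℕ → ℕ → ℤ) (t : ℕ) : ℕ :=
  ∑ u ∈ Finset.Ico (blockStart μ t) t, rOffDual N μ T u

/-- Entries outside the shape are normalized to `0`. -/
def PadZeroT (s : ℕ) (μ : ℕ → ℕ) (T : ℕ → ℕ → ℤ) : Prop :=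
  ∀ x t : ℕ, s ≤ t ∨ μ t ≤ x → T x t = 0

/-- `μ` encodes (the conjugate of) a partition `λ ∈ 𝒫_m ∩ 𝒫_n` with `s` columns. -/
def ShapeOK (m n s : ℕ) (μ : ℕ → ℕ) : Prop :=
  (∀ t : ℕ, t + 1 < s → μ (t + 1) ≤ μ t) ∧ (∀ t < s, 0 < μ t ∧ μ t ≤ m ∧ μ t ≤ n) ∧
    ∀ t : ℕ, s ≤ t → μ t = 0

/-- Dual shape condition: `λ ∈ 𝒫_n`. -/
def ShapeOK' (n s : ℕ) (μ : ℕ → ℕ) : Prop :=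
  (∀ t : ℕ, t + 1 < s → μ (t + 1) ≤ μ t) ∧ (∀ t < s, 0 < μ t ∧ μ t ≤ n) ∧
    ∀ t : ℕ, s ≤ t → μ t = 0

/-- `κ(A) = (P, Q)` where `Q` is obtained by shifting the `t`-th column of `Q₀`
by `τ_n^{ρ_t + η_t}` (`η` the symmetrized offset vector of `P₀`). -/
def KappaRel (m n : ℕ) (A : Mat) (s : ℕ) (μ : ℕ → ℕ) (P Q : ℕ → ℕ → ℤ) : Prop :=
  ∃ (P' Q' : ℕ → ℕ → ℤ) (ρ : ℕ → ℤ),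
    Kappa0Rel m n A s μ P' Q' ρ ∧
    (∀ t < s, ∀ x < μ t,
      P x t = P' x t ∧
        Q x t = tauPow n (μ t) (ρ t + (etaCol m μ P' t : ℤ)) (fun y => Q' y t) x) ∧
    PadZeroT s μ P ∧ PadZeroT s μ Q ∧ ∀ t : ℕ, s ≤ t → μ t = 0

def KappaRel' (m n : ℕ) (A : Mat) (s : ℕ) (μ : ℕ → ℕ) (P Q : ℕ → ℕ → ℤ) : Prop :=
  ∃ (P' Q' : ℕ → ℕ → ℤ) (ρ : ℕ → ℤ),
    Kappa0Rel' m n A s μ P' Q' ρ ∧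
    (∀ t < s, ∀ x < μ t,
      P x t = P' x t ∧
        Q x t = tauPow n (μ t) (ρ t + (etaColDual m μ P' t : ℤ)) (fun y => Q' y t) x) ∧
    PadZeroT s μ P ∧ PadZeroT s μ Q ∧ ∀ t : ℕ, s ≤ t → μ t = 0

/-- Membership in `⨆_{λ ∈ 𝒫_m ∩ 𝒫_n} CSST_[m](λ) × B_n(λ)`:
`P` is column semistandard with entries in `{1, …, m}` and `Q` is a
`ℤ`-semistandard filling whose columns span less than `n` and whose rows
weakly increase within each rectangle block. -/
def InTargetRSK (m n s : ℕ) (μ : ℕ → ℕ) (P Q : ℕ → ℕ → ℤ) : Prop :=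
  ShapeOK m n s μ ∧ PadZeroT s μ P ∧ PadZeroT s μ Q ∧
  (∀ t < s, ∀ x : ℕ, x + 1 < μ t → P x t < P (x + 1) t) ∧
  (∀ t < s, ∀ x < μ t, 1 ≤ P x t ∧ P x t ≤ (m : ℤ)) ∧
  (∀ t < s, ∀ x : ℕ, x + 1 < μ t → Q x t < Q (x + 1) t) ∧
  (∀ t < s, Q (μ t - 1) t - Q 0 t < (n : ℤ)) ∧
    ∀ t : ℕ, t + 1 < s → μ t = μ (t + 1) → ∀ x < μ t, Q x t ≤ Q x (t + 1)

/-- Membership in `⨆_{λ ∈ 𝒫_n} RSST_[m](λ') × B_n(λ)`; the first component is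
encoded by `P = P₀` (whose columns, weakly increasing with entries in
`{1, …, m}`, are the rows of `P₀ᵗ ∈ RSST_[m](λ')`). -/
def InTargetDual (m n s : ℕ) (μ : ℕ → ℕ) (P Q : ℕ → ℕ → ℤ) : Prop :=
  ShapeOK' n s μ ∧ PadZeroT s μ P ∧ PadZeroT s μ Q ∧
  (∀ t < s, ∀ x : ℕ, x + 1 < μ t → P x t ≤ P (x + 1) t) ∧
  (∀ t < s, ∀ x < μ t, 1 ≤ P x t ∧ P x t ≤ (m : ℤ)) ∧
  (∀ t < s, ∀ x : ℕ, x + 1 < μ t → Q x t < Q (x + 1) t) ∧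
  (∀ t < s, Q (μ t - 1) t - Q 0 t < (n : ℤ)) ∧
    ∀ t : ℕ, t + 1 < s → μ t = μ (t + 1) → ∀ x < μ t, Q x t ≤ Q x (t + 1)

/-- Dominance of a triple `(P, Q, ρ)`: within each rectangle block, the
sequence `ρ - ζ` (read right to left) is weakly decreasing, where
`ζ = θ - η` with `η`, `θ` the symmetrized offset vectors of `P`, `Q`. -/
def Dominant (m n s : ℕ) (μ : ℕ → ℕ) (P Q : ℕ → ℕ → ℤ) (ρ : ℕ → ℤ) : Prop :=
  ∀ t : ℕ, t + 1 < s → μ t = μ (t + 1) →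
    ρ t - ((etaCol n μ Q t : ℤ) - (etaCol m μ P t : ℤ)) ≤
      ρ (t + 1) - ((etaCol n μ Q (t + 1) : ℤ) - (etaCol m μ P (t + 1) : ℤ))

/-- `κ₀(A) = (P, Q, ρ)` with all data normalized outside the shape. -/
def Kappa0RelPad (m n : ℕ) (A : Mat) (s : ℕ) (μ : ℕ → ℕ) (P Q : ℕ → ℕ → ℤ)
    (ρ : ℕ → ℤ) : Prop :=
  ∃ P' Q' : ℕ → ℕ → ℤ,
    Kappa0Rel m n A s μ P' Q' ρ ∧
    (∀ t < s, ∀ x < μ t, P x t = P' x t ∧ Q x t = Q' x t) ∧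
    PadZeroT s μ P ∧ PadZeroT s μ Q ∧ (∀ t : ℕ, s ≤ t → μ t = 0) ∧
      ∀ t : ℕ, s ≤ t → ρ t = 0

/-- Membership in `Ω_dom`. -/
def InOmegaDom (m n s : ℕ) (μ : ℕ → ℕ) (P Q : ℕ → ℕ → ℤ) (ρ : ℕ → ℤ) : Prop :=
  ShapeOK m n s μ ∧ PadZeroT s μ P ∧ PadZeroT s μ Q ∧ (∀ t : ℕ, s ≤ t → ρ t = 0) ∧
  (∀ t < s, ∀ x : ℕ, x + 1 < μ t → P x t < P (x + 1) t) ∧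
  (∀ t < s, ∀ x < μ t, 1 ≤ P x t ∧ P x t ≤ (m : ℤ)) ∧
  (∀ t < s, ∀ x : ℕ, x + 1 < μ t → Q x t < Q (x + 1) t) ∧
  (∀ t < s, ∀ x < μ t, 1 ≤ Q x t ∧ Q x t ≤ (n : ℤ)) ∧
    Dominant m n s μ P Q ρ

/-- `A` has width `l`: some proper numbering has period `l`. -/
def HasWidth (m n : ℕ) (A : Mat) (l : ℕ) : Prop :=
  ∃ d : Cell → ℤ, IsProper A d ∧ ∀ c ∈ supp A, d (tauC m n c) = d c + (l : ℤ)

/-! ### Crystal operators on matrices -/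

/-- The first `+` of column `j` (row `i`) survives the signature reduction of
the sequence `σ` attached to rows `i, i+1`. -/
def SurvPlus (A : Mat) (i j : ℤ) : Prop :=
  0 < A i j ∧ ∀ j' : ℤ, j < j' →
    (∑ t ∈ Finset.Ioc j j', A (i + 1) t) ≤ (A i j - 1) + ∑ t ∈ Finset.Ioo j j', A i t

/-- The last `-` of column `j` (row `i+1`) survives the reduction. -/
def SurvMinus (A : Mat) (i j : ℤ) : Prop :=
  0 < A (i + 1) j ∧ ∀ j' : ℤ, j' < j →
    (∑ t ∈ Finset.Ico j' j, A i t) ≤ (A (i + 1) j - 1) + ∑ t ∈ Finset.Ioo j' j, A (i + 1) t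

/-- `A - Ê_{i₁ j} + Ê_{i₂ j}`. -/
noncomputable def subAddAt (m n : ℕ) (i₁ i₂ j : ℤ) (A : Mat) : Mat :=
  fun x y =>
    if ∃ k : ℤ, x = i₁ + k * m ∧ y = j + k * n then A x y - 1
    else if ∃ k : ℤ, x = i₂ + k * m ∧ y = j + k * n then A x y + 1
    else A x y

/-- `f̃_i` on `M̂_{m×n}`, `0`-valued results encoded by `none`. -/
noncomputable def fMat (m n : ℕ) (i : ℤ) (A : Mat) : Option Mat :=
  if h : ∃ j : ℤ, SurvPlus A i j ∧ ∀ j' : ℤ, SurvPlus A i j' → j ≤ j' then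
    some (subAddAt m n i (i + 1) h.choose A)
  else none

/-- `ẽ_i` on `M̂_{m×n}`. -/
noncomputable def eMat (m n : ℕ) (i : ℤ) (A : Mat) : Option Mat :=
  if h : ∃ j : ℤ, SurvMinus A i j ∧ ∀ j' : ℤ, SurvMinus A i j' → j' ≤ j then
    some (subAddAt m n (i + 1) i h.choose A)
  else none

def transM (A : Mat) : Mat := fun i j => A j i

/-- `f̃^t_j A = (f̃_j (Aᵗ))ᵗ`. -/
noncomputable def fMatT (m n : ℕ) (j : ℤ) (A : Mat) : Option Mat :=
  (fMat n m j (transM A)).map transM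

/-- `ẽ^t_j A = (ẽ_j (Aᵗ))ᵗ`. -/
noncomputable def eMatT (m n : ℕ) (j : ℤ) (A : Mat) : Option Mat :=
  (eMat n m j (transM A)).map transM

/-- Row operator (`f̃_i` if `x = true`, `ẽ_i` if `x = false`) on `M̂ ∪ {0}`. -/
noncomputable def rowOp (m n : ℕ) (x : Bool) (i : ℤ) (o : Option Mat) : Option Mat :=
  o.bind (if x then fMat m n i else eMat m n i)

/-- Column operator (`f̃^t_j` or `ẽ^t_j`) on `M̂ ∪ {0}`. -/
noncomputable def colOp (m n : ℕ) (y : Bool) (j : ℤ) (o : Option Mat) : Option Mat :=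
  o.bind (if y then fMatT m n j else eMatT m n j)

/-- The `+` of row `u`, column `j` survives the signature reduction of the
sequence attached to columns `j, j+1` (read along rows, top to bottom). -/
def ColSurvPlus (A : Mat) (j u : ℤ) : Prop :=
  0 < A u j ∧ ∀ u' : ℤ, u < u' →
    (∑ i ∈ Finset.Ioc u u', A i (j + 1)) ≤ (A u j - 1) + ∑ i ∈ Finset.Ioo u u', A i j

/-- `A - Ê_{u j} + Ê_{u, j+1}`, the result of `f̃^t_j` acting at row `u`. -/
noncomputable def ftApply (m n : ℕ) (u j : ℤ) (A : Mat) : Mat :=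
  fun x y =>
    if ∃ k : ℤ, x = u + k * m ∧ y = j + k * n then A x y - 1
    else if ∃ k : ℤ, x = u + k * m ∧ y = j + 1 + k * n then A x y + 1
    else A x y

/-! ### Crystal operators on tableaux -/

/-- Column `t` of `P` contributes a `+` for the letter `i`. -/
def PhasPlus (μ : ℕ → ℕ) (P : ℕ → ℕ → ℤ) (i : ℤ) (t : ℕ) : Prop :=
  (∃ x < μ t, P x t = i) ∧ ∀ x < μ t, P x t ≠ i + 1

/-- Column `t` of `P` contributes a `-` for the letter `i`. -/
def PhasMinus (μ : ℕ → ℕ) (P : ℕ → ℕ → ℤ) (i : ℤ) (t : ℕ) : Prop :=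
  (∃ x < μ t, P x t = i + 1) ∧ ∀ x < μ t, P x t ≠ i

/-- The `+` of column `t` survives the tensor-product signature reduction
(factors are the columns read from right to left). -/
def PSurvPlus (μ : ℕ → ℕ) (P : ℕ → ℕ → ℤ) (i : ℤ) (t : ℕ) : Prop :=
  PhasPlus μ P i t ∧ ∀ t' < t,
    ((Finset.Ico t' t).filter (fun u => PhasMinus μ P i u)).card ≤
      ((Finset.Ioo t' t).filter (fun u => PhasPlus μ P i u)).card

def PSurvMinus (μ : ℕ → ℕ) (P : ℕ → ℕ → ℤ) (i : ℤ) (t : ℕ) : Prop :=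
  PhasMinus μ P i t ∧ ∀ t'' : ℕ, t < t'' →
    ((Finset.Ioc t t'').filter (fun u => PhasPlus μ P i u)).card ≤
      ((Finset.Ioo t t'').filter (fun u => PhasMinus μ P i u)).card

/-- `f̃_i` on `P` acting on column `t₀` (replace the letter `i` by `i + 1`). -/
noncomputable def applyPF (μ : ℕ → ℕ) (P : ℕ → ℕ → ℤ) (i : ℤ) (t₀ : ℕ) :
    ℕ → ℕ → ℤ :=
  fun x t => if t = t₀ ∧ x < μ t ∧ P x t = i then i + 1 else P x t

/-- `ẽ_i` on `P` acting on column `t₀`. -/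
noncomputable def applyPE (μ : ℕ → ℕ) (P : ℕ → ℕ → ℤ) (i : ℤ) (t₀ : ℕ) :
    ℕ → ℕ → ℤ :=
  fun x t => if t = t₀ ∧ x < μ t ∧ P x t = i + 1 then i else P x t

/-- The entry at position `k` of a column `c` of height `b` can be increased. -/
def QmovUp (n b : ℕ) (c : ℕ → ℤ) (k : ℕ) : Prop :=
  (k + 1 < b ∧ c k + 1 < c (k + 1)) ∨ (k + 1 = b ∧ c (b - 1) < c 0 + (n : ℤ) - 1)

/-- The entry at position `k` of a column `c` of height `b` can be decreased. -/
def QmovDown (n b : ℕ) (c : ℕ → ℤ) (k : ℕ) : Prop :=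
  (0 < k ∧ c (k - 1) < c k - 1) ∨ (k = 0 ∧ c (b - 1) < c 0 + (n : ℤ) - 1)

def QhasPlus (n : ℕ) (μ : ℕ → ℕ) (Q : ℕ → ℕ → ℤ) (j : ℤ) (t : ℕ) : Prop :=
  ∃ k < μ t, Int.emod (Q k t) (n : ℤ) = j ∧ QmovUp n (μ t) (fun y => Q y t) k

def QhasMinus (n : ℕ) (μ : ℕ → ℕ) (Q : ℕ → ℕ → ℤ) (j : ℤ) (t : ℕ) : Prop :=
  ∃ k < μ t, Int.emod (Q k t) (n : ℤ) = Int.emod (j + 1) (n : ℤ) ∧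
    QmovDown n (μ t) (fun y => Q y t) k

def QSurvPlus (n : ℕ) (μ : ℕ → ℕ) (Q : ℕ → ℕ → ℤ) (j : ℤ) (t : ℕ) : Prop :=
  QhasPlus n μ Q j t ∧ ∀ t' < t,
    ((Finset.Ico t' t).filter (fun u => QhasMinus n μ Q j u)).card ≤
      ((Finset.Ioo t' t).filter (fun u => QhasPlus n μ Q j u)).card

def QSurvMinus (n : ℕ) (μ : ℕ → ℕ) (Q : ℕ → ℕ → ℤ) (j : ℤ) (t : ℕ) : Prop :=
  QhasMinus n μ Q j t ∧ ∀ t'' : ℕ, t < t'' →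
    ((Finset.Ioc t t'').filter (fun u => QhasPlus n μ Q j u)).card ≤
      ((Finset.Ioo t t'').filter (fun u => QhasMinus n μ Q j u)).card

/-- `f̃^t_j` on `Q` acting on column `t₀`. -/
noncomputable def applyQF (n : ℕ) (μ : ℕ → ℕ) (Q : ℕ → ℕ → ℤ) (j : ℤ) (t₀ : ℕ) :
    ℕ → ℕ → ℤ :=
  fun x t =>
    if t = t₀ ∧ x < μ t ∧ Int.emod (Q x t) (n : ℤ) = j ∧
        QmovUp n (μ t) (fun y => Q y t) x
    then Q x t + 1 else Q x t

/-- `ẽ^t_j` on `Q` acting on column `t₀`. -/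
noncomputable def applyQE (n : ℕ) (μ : ℕ → ℕ) (Q : ℕ → ℕ → ℤ) (j : ℤ) (t₀ : ℕ) :
    ℕ → ℕ → ℤ :=
  fun x t =>
    if t = t₀ ∧ x < μ t ∧ Int.emod (Q x t) (n : ℤ) = Int.emod (j + 1) (n : ℤ) ∧
        QmovDown n (μ t) (fun y => Q y t) x
    then Q x t - 1 else Q x t

/-! ### Standardization -/

noncomputable def rowSumA (A : Mat) (i : ℤ) : ℕ := ∑ᶠ j : ℤ, A i j

noncomputable def colSumA (A : Mat) (j : ℤ) : ℕ := ∑ᶠ i : ℤ, A i j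

/-- `A ∈ M̂_{m×n}(α, β)`. -/
def InMhatAB (m n : ℕ) (α β : ℕ → ℕ) (A : Mat) : Prop :=
  IsGAP m n A ∧ (∀ i : ℕ, 1 ≤ i → i ≤ m → rowSumA A i = α i) ∧
    ∀ j : ℕ, 1 ≤ j → j ≤ n → colSumA A j = β j

/-- Extended affine permutations `W̃_K`. -/
def IsEAP (K : ℕ) (B : Mat) : Prop :=
  IsGAP K K B ∧ (∀ i j : ℤ, B i j ≤ 1) ∧ (∀ i : ℤ, ∃! j : ℤ, B i j ≠ 0) ∧
    ∀ j : ℤ, ∃! i : ℤ, B i j ≠ 0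

/-- `i` is a descent of the matrix `B`. -/
def IsDescentM (B : Mat) (i : ℤ) : Prop :=
  ∃ j j' : ℤ, B i j ≠ 0 ∧ B (i + 1) j' ≠ 0 ∧ j' < j

/-- Partial sums `α₁ + ⋯ + α_i`. -/
def psum (α : ℕ → ℕ) (i : ℕ) : ℕ := ∑ u ∈ Finset.Icc 1 i, α u

/-- `B` is `α`-descending. -/
def AlphaDescending (m : ℕ) (α : ℕ → ℕ) (B : Mat) : Prop :=
  ∀ k : ℕ, 1 ≤ k → k ≤ m → ∀ i : ℤ,
    (psum α (k - 1) : ℤ) < i → i < (psum α k : ℤ) → IsDescentM B i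

/-- `B` is `(α, β)`-descending. -/
def IsABDescending (m n : ℕ) (α β : ℕ → ℕ) (B : Mat) : Prop :=
  AlphaDescending m α B ∧ AlphaDescending n β (transM B)

/-- `B` standardizes `A`: blockwise entry sums of `B` over `𝓘_i × 𝓙_j`
equal the entries of `A`. -/
def PermOf (m n K : ℕ) (α β : ℕ → ℕ) (A B : Mat) : Prop :=
  ∀ (i₀ j₀ : ℕ) (q r : ℤ), 1 ≤ i₀ → i₀ ≤ m → 1 ≤ j₀ → j₀ ≤ n →
    A ((i₀ : ℤ) + q * m) ((j₀ : ℤ) + r * n) =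
      ∑ k ∈ Finset.Icc ((psum α (i₀ - 1) : ℤ) + q * K + 1) ((psum α i₀ : ℤ) + q * K),
        ∑ l ∈ Finset.Icc ((psum β (j₀ - 1) : ℤ) + r * K + 1) ((psum β j₀ : ℤ) + r * K),
          B k l

/-- Standardization of a column-semistandard tableau: for each value `v`, its
occurrences, from left to right, are replaced by consecutive integers starting
after the number of strictly smaller entries. -/
noncomputable def stdT (s : ℕ) (μ : ℕ → ℕ) (T : ℕ → ℕ → ℤ) : ℕ → ℕ → ℤ :=
  fun x t =>
    ((∑ t' ∈ Finset.range s,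
        ((Finset.range (μ t')).filter (fun x' => T x' t' < T x t)).card : ℕ) : ℤ) +
      (((Finset.range t).filter (fun t' => ∃ x' < μ t', T x' t' = T x t)).card : ℤ) + 1

/-- `i` is a (column) descent of the tableau `T`: the letter `i + 1` occurs in
a column strictly to the right of the column containing `i`. -/
def IsDescentT (s : ℕ) (μ : ℕ → ℕ) (T : ℕ → ℕ → ℤ) (i : ℤ) : Prop :=
  ∃ t < s, ∃ t' < s, ∃ x < μ t, ∃ x' < μ t', T x t = i ∧ T x' t' = i + 1 ∧ t < t'

/-! ### Rectangles, `B_n(R)` and `B_n(R)₀` (columns indexed from the right) -/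

/-- `T ∈ B_n(R)` for the rectangle `R = (a^b)`; `T j x` is the entry at row `x`
of the `(j+1)`-st column from the right, normalized to `0` outside the shape. -/
def InBnR (n a b : ℕ) (T : ℕ → ℕ → ℤ) : Prop :=
  (∀ j : ℕ, j + 1 < a → ∀ x < b, T (j + 1) x ≤ T j x) ∧
  (∀ j < a, ∀ x : ℕ, x + 1 < b → T j x < T j (x + 1)) ∧
  (∀ j < a, T j (b - 1) - T j 0 < (n : ℤ)) ∧
    ∀ j x : ℕ, a ≤ j ∨ b ≤ x → T j x = 0

/-- `T ∈ B_n(R)₀`: `(T^{j+1}, τ_n^{-1}(T^j))` is not semistandard for any `j`. -/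
def InBnR0 (n a b : ℕ) (T : ℕ → ℕ → ℤ) : Prop :=
  InBnR n a b T ∧
    ∀ j : ℕ, j + 1 < a → ¬ ∀ x < b, T (j + 1) x ≤ tauPow n b (-1) (fun y => T j y) x

/-- `ν ∈ 𝒫_{a-1}`: a partition `ν₁ ≥ ⋯ ≥ ν_{a-1} ≥ 0`, normalized. -/
def IsPartLen (a : ℕ) (ν : ℕ → ℕ) : Prop :=
  ν 0 = 0 ∧ (∀ j : ℕ, 1 ≤ j → j + 2 ≤ a → ν (j + 1) ≤ ν j) ∧ ∀ j : ℕ, a ≤ j → ν j = 0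

/-- `(T, ν) ↦ τ_n^{ν_rev}(T)`: the column `j` (from the right, 0-based) is
shifted by `τ_n^{ν_{j+1}}`. -/
noncomputable def PhiMap (n a b : ℕ) (T : ℕ → ℕ → ℤ) (ν : ℕ → ℕ) : ℕ → ℕ → ℤ :=
  fun j x => if j < a ∧ x < b then tauPow n b ((ν (j + 1) : ℤ)) (fun y => T j y) x else 0

/-- The offset `r_j` of `T` (columns from the right, paper indexing `j ≥ 1`). -/
noncomputable def rOffR (n b : ℕ) (T : ℕ → ℕ → ℤ) (j : ℕ) : ℕ :=
  sInf {r : ℕ | ∀ x < b, T j x ≤ tauPow n b ((r : ℤ)) (fun y => T (j - 1) y) x}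

/-- The symmetrized offset `η_j = r_j + ⋯ + r_{a-1}`. -/
noncomputable def etaR (n a b : ℕ) (T : ℕ → ℕ → ℤ) (j : ℕ) : ℕ :=
  ∑ u ∈ Finset.Icc j (a - 1), rOffR n b T u

/-! ### The two-column setup -/

/-- Row coordinates of the stream with defining data `(a, ·, ρ)`:
`X(p + ρ + ql) = a(p) + qm` for `1 ≤ p ≤ l`. -/
def streamX (m l : ℕ) (a : ℕ → ℤ) (ρ : ℤ) (idx : ℤ) : ℤ := colExt m l a (idx - ρ - 1)

/-- Column coordinates: `Y(p + ql) = b(p) + qn` for `1 ≤ p ≤ l`. -/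
def streamY (n l : ℕ) (b : ℕ → ℤ) (idx : ℤ) : ℤ := colExt n l b (idx - 1)

/-- The matrix built from the interleaved streams `t` and `t'`. -/
noncomputable def twoColMat (m n l : ℕ) (a1 a2 b1 b2 : ℕ → ℤ) (ρ₁ ρ₂ k : ℤ) : Mat :=
  fun x y =>
    (if ∃ i : ℤ, streamX m l a2 ρ₂ (i + k) = x ∧ streamY n l b1 i = y then 1 else 0) +
      (if ∃ i : ℤ, streamX m l a1 ρ₁ i = x ∧ streamY n l b2 (i + k) = y then 1 else 0)



/-! ### Zig-zags -/

def VZ (z : ℤ → Cell) (x y : ℤ) : Prop := ∃ i, (z i).1 ≤ x ∧ (z i).2 ≤ y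

lemma zz_mono {z : ℤ → Cell} (hz : IsZigZag z) {i j : ℤ} (h : i ≤ j) :
    (z j).1 ≤ (z i).1 ∧ (z i).2 ≤ (z j).2 ∧ (z j).2 - (z j).1 = (z i).2 - (z i).1 + (j - i) := by
  induction j, h using Int.leInduction with
  | base => simp
  | succ j hj ih =>
    rcases hz.1 j with h | h <;> rw [h] <;> simp only <;> omega

lemma zz_inner_iff {z : ℤ → Cell} (hz : IsZigZag z) (x y : ℤ) :
    (x, y) ∈ innerCorners z ↔ VZ z x y ∧ ¬ VZ z (x - 1) y ∧ ¬ VZ z x (y - 1) := by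
  constructor
  · rintro ⟨i, h1, h2, h3⟩
    rw [h1] at h2 h3
    have e1 := congrArg Prod.fst h2
    have e2 := congrArg Prod.snd h2
    have e3 := congrArg Prod.fst h1
    have e4 := congrArg Prod.snd h1
    have e5 := congrArg Prod.fst h3
    have e6 := congrArg Prod.snd h3
    simp only at e1 e2 e3 e4 e5 e6
    refine ⟨⟨i, by omega, by omega⟩, ?_, ?_⟩
    · rintro ⟨j, hj1, hj2⟩
      rcases le_or_gt j i with h | h
      · have := zz_mono hz h; omega
      · have := zz_mono hz (show i + 1 ≤ j by omega); omega
    · rintro ⟨j, hj1, hj2⟩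
      rcases le_or_gt i j with h | h
      · have := zz_mono hz h; omega
      · have := zz_mono hz (show j ≤ i - 1 by omega); omega
  · rintro ⟨⟨i, h1, h2⟩, h3, h4⟩
    have e1 : (z i).1 = x := by
      by_contra h; exact h3 ⟨i, by omega, h2⟩
    have e2 : (z i).2 = y := by
      by_contra h; exact h4 ⟨i, h1, by omega⟩
    refine ⟨i, Prod.ext e1 e2, ?_, ?_⟩
    · rcases hz.1 (i - 1) with h | h
      · exfalso
        rw [sub_add_cancel] at h
        have f1 := congrArg Prod.fst h
        have f2 := congrArg Prod.snd h
        simp only at f1 f2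
        exact h4 ⟨i - 1, by omega, by omega⟩
      · rw [sub_add_cancel] at h; exact h
    · rcases hz.1 i with h | h
      · exact h
      · exfalso
        have f1 := congrArg Prod.fst h
        have f2 := congrArg Prod.snd h
        simp only at f1 f2
        exact h3 ⟨i + 1, by omega, by omega⟩

lemma zz_outer_iff {z : ℤ → Cell} (hz : IsZigZag z) (x y : ℤ) :
    (x, y) ∈ outerCorners z ↔ VZ z (x - 1) y ∧ VZ z x (y - 1) ∧ ¬ VZ z (x - 1) (y - 1) := by
  constructor
  · rintro ⟨i, h1, h2, h3⟩
    rw [h1] at h2 h3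
    have e1 := congrArg Prod.fst h2
    have e2 := congrArg Prod.snd h2
    have e3 := congrArg Prod.fst h1
    have e4 := congrArg Prod.snd h1
    have e5 := congrArg Prod.fst h3
    have e6 := congrArg Prod.snd h3
    simp only at e1 e2 e3 e4 e5 e6
    refine ⟨⟨i + 1, by omega, by omega⟩, ⟨i - 1, by omega, by omega⟩, ?_⟩
    rintro ⟨j, hj1, hj2⟩
    rcases le_or_gt j i with h | h
    · have := zz_mono hz h; omega
    · have := zz_mono hz h.le; omega
  · rintro ⟨⟨i, h1, h2⟩, ⟨j, h3, h4⟩, h5⟩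
    have e1 : (z i).2 = y := by
      by_contra h; exact h5 ⟨i, h1, by omega⟩
    have e2 : (z j).1 = x := by
      by_contra h; exact h5 ⟨j, by omega, h4⟩
    have hji : j < i := by
      by_contra h
      have := zz_mono hz (not_lt.mp h); omega
    obtain ⟨t, ht⟩ : ∃ t, t = j + ((y - x) - ((z j).2 - (z j).1)) := ⟨_, rfl⟩
    have hA := zz_mono hz hji.le
    have htj : j < t := by omega
    have hti : t < i := by omega
    have hB := zz_mono hz htj.le
    have hC := zz_mono hz hti.le
    have g1 : (z t).1 = x := by
      by_contra h; exact h5 ⟨t, by omega, by omega⟩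
    have g2 : (z t).2 = y := by omega
    refine ⟨t, Prod.ext g1 g2, ?_, ?_⟩
    · have h := hz.1 (t - 1)
      rw [sub_add_cancel] at h
      rcases h with h | h
      · exact h
      · exfalso
        have f1 := congrArg Prod.fst h
        simp only at f1
        have := zz_mono hz (show j ≤ t - 1 by omega); omega
    · rcases hz.1 t with h | h
      · exfalso
        have f1 := congrArg Prod.snd h
        simp only at f1
        have := zz_mono hz (show t + 1 ≤ i by omega); omega
      · exact h

lemma zz_V_iff {z : ℤ → Cell} (hz : IsZigZag z) (x y : ℤ) :
    VZ z x y ↔ ∃ c ∈ innerCorners z, c.1 ≤ x ∧ c.2 ≤ y := by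
  constructor
  · rintro ⟨i, h1, h2⟩
    obtain ⟨-, ⟨N, hN⟩, ⟨M, hM⟩⟩ := id hz
    by_cases hi : z i = ((z (i - 1)).1 - 1, (z (i - 1)).2)
    · -- go forward
      have hex : ∃ j, i ≤ j ∧ z (j + 1) = ((z j).1, (z j).2 + 1) :=
        ⟨max i N, le_max_left _ _, hN _ (le_max_right _ _)⟩
      obtain ⟨j, ⟨hj, hje⟩, hmin⟩ := Int.exists_least_of_bdd
        (P := fun j => i ≤ j ∧ z (j + 1) = ((z j).1, (z j).2 + 1)) ⟨i, fun _ h => h.1⟩ hex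
      have key : ∀ k, i ≤ k → k ≤ j → (z k).2 = (z i).2 ∧ z k = ((z (k - 1)).1 - 1, (z (k - 1)).2) := by
        intro k hk
        induction k, hk using Int.leInduction with
        | base => intro _; exact ⟨rfl, hi⟩
        | succ k hk ih =>
          intro hkj
          have := ih (by omega)
          rcases hz.1 k with h | h
          · have := hmin k ⟨hk, h⟩; omega
          · rw [add_sub_cancel_right]
            refine ⟨?_, h⟩
            rw [h]; exact this.1
      have kj := key j hj le_rfl
      exact ⟨z j, ⟨j, rfl, kj.2, hje⟩, by have := zz_mono hz hj; omega, by omega⟩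
    · have hi' : z i = ((z (i - 1)).1, (z (i - 1)).2 + 1) := by
        have h := hz.1 (i - 1)
        rw [sub_add_cancel] at h
        rcases h with h | h
        · exact h
        · exact absurd h hi
      have hex : ∃ j, j ≤ i ∧ z j = ((z (j - 1)).1 - 1, (z (j - 1)).2) := by
        refine ⟨min i (M + 1), min_le_left _ _, ?_⟩
        have := hM (min i (M + 1) - 1) (by have := min_le_right i (M + 1); omega)
        rwa [sub_add_cancel] at this
      obtain ⟨j, ⟨hj, hje⟩, hmax⟩ := Int.exists_greatest_of_bdd
        (P := fun j => j ≤ i ∧ z j = ((z (j - 1)).1 - 1, (z (j - 1)).2)) ⟨i, fun _ h => h.1⟩ hex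
      have hne : j ≠ i := by rintro rfl; exact hi hje
      have hst : ∀ k, j < k → k ≤ i → z k = ((z (k - 1)).1, (z (k - 1)).2 + 1) := by
        intro k hk hki
        have h := hz.1 (k - 1)
        rw [sub_add_cancel] at h
        rcases h with h | h
        · exact h
        · have := hmax k ⟨hki, h⟩; omega
      have key : ∀ k, j ≤ k → k ≤ i → (z k).1 = (z j).1 := by
        intro k hk
        induction k, hk using Int.leInduction with
        | base => intro _; rfl
        | succ k hk ih =>
          intro hki
          have h1 := ih (by omega)
          have h2 := hst (k + 1) (by omega) hki
          rw [add_sub_cancel_right] at h2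
          rw [h2]; exact h1
      refine ⟨z j, ⟨j, rfl, hje, ?_⟩, ?_, ?_⟩
      · have := hst (j + 1) (by omega) (by omega)
        rwa [add_sub_cancel_right] at this
      · have := key i hj le_rfl; omega
      · have := zz_mono hz hj; omega
  · rintro ⟨c, ⟨i, rfl, -⟩, h⟩
    exact ⟨i, h⟩

lemma zz_exists (U : ℤ → ℤ → Prop) (hU : ∀ x y x' y', x ≤ x' → y ≤ y' → U x y → U x' y')
    (x0 y1 x1 y0 : ℤ) (h1 : U x0 y1) (h2 : U x1 y0) (h3 : ∀ x y, U x y → x0 ≤ x ∧ y0 ≤ y) :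
    ∃ z, IsZigZag z ∧ ∀ x y, VZ z x y ↔ U x y := by
  have hex : ∀ i : ℤ, ∃ x, U x (x + i) ∧ ∀ x', U x' (x' + i) → x ≤ x' := by
    intro i
    have hh : ∃ x, U x (x + i) := by
      refine ⟨max x0 (y1 - i), hU _ _ _ _ (le_max_left _ _) ?_ h1⟩
      have := le_max_right x0 (y1 - i); omega
    exact Int.exists_least_of_bdd (P := fun x => U x (x + i)) ⟨x0, fun x h => (h3 _ _ h).1⟩ hh
  choose X hX hmin using hex
  refine ⟨fun i => (X i, X i + i), ⟨?_, ?_, ?_⟩, ?_⟩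
  · intro i
    have a1 : X (i + 1) ≤ X i := hmin _ _ (hU _ _ _ _ le_rfl (by omega) (hX i))
    have a2 : X i ≤ X (i + 1) + 1 := hmin _ _ (hU _ _ _ _ (by omega) (by omega) (hX (i + 1)))
    simp only [Prod.mk.injEq]
    omega
  · refine ⟨y1 - x0, fun i hi => ?_⟩
    have key : ∀ j, y1 - x0 ≤ j → X j = x0 := fun j hj =>
      le_antisymm (hmin _ _ (hU _ _ _ _ le_rfl (by omega) h1)) (h3 _ _ (hX j)).1
    simp only [Prod.mk.injEq]
    rw [key i hi, key (i + 1) (by omega)]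
    omega
  · refine ⟨y0 - x1 - 1, fun i hi => ?_⟩
    have key : ∀ j, j ≤ y0 - x1 → X j = y0 - j := fun j hj =>
      le_antisymm (hmin _ _ (hU _ _ _ _ (by omega) (by omega) h2))
        (by have := (h3 _ _ (hX j)).2; omega)
    simp only [Prod.mk.injEq]
    rw [key i (by omega), key (i + 1) (by omega)]
    omega
  · intro x y
    constructor
    · rintro ⟨i, h4, h5⟩
      exact hU _ _ _ _ h4 h5 (hX i)
    · intro h
      have : X (y - x) ≤ x := hmin _ _ (by rwa [add_sub_cancel])
      exact ⟨y - x, this, by simp only; omega⟩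


/-! ### Periodic proper numberings -/

def shC (m n : ℕ) (q : ℤ) (c : Cell) : Cell := (c.1 + q * m, c.2 + q * n)

structure Num (m n : ℕ) (A : Mat) (d : Cell → ℤ) (l : ℕ) : Prop where
  hm : 0 < m
  hn : 0 < n
  hl : 0 < l
  ne : ∃ c, c ∈ supp A
  per : ∀ c, tauC m n c ∈ supp A ↔ c ∈ supp A
  fin : ∃ F : Set Cell, F.Finite ∧ ∀ c ∈ supp A, ∃ c0 ∈ F, ∃ q : ℤ, c = shC m n q c0
  dper : ∀ c ∈ supp A, d (tauC m n c) = d c + l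
  lt : ∀ c₁ ∈ supp A, ∀ c₂ ∈ supp A, NW c₂ c₁ → d c₂ < d c₁
  pred : ∀ c ∈ supp A, ∃ c₂ ∈ supp A, NW c₂ c ∧ d c₂ = d c - 1

lemma tauC_shC (m n : ℕ) (q : ℤ) (c : Cell) : tauC m n (shC m n q c) = shC m n (q + 1) c := by
  simp only [tauC, shC, Prod.mk.injEq]; constructor <;> ring

lemma shC_mem {m n : ℕ} {A : Mat} (hp : ∀ c, tauC m n c ∈ supp A ↔ c ∈ supp A) (q : ℤ) (c : Cell) :
    shC m n q c ∈ supp A ↔ c ∈ supp A := by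
  induction q using Int.induction_on with
  | zero => simp [shC]
  | succ q ih => rw [← tauC_shC, hp, ih]
  | pred q ih =>
    rw [← ih, ← hp (shC m n (-q - 1) c), tauC_shC, sub_add_cancel]

namespace Num
variable {m n : ℕ} {A : Mat} {d : Cell → ℤ} {l : ℕ} (H : Num m n A d l)
include H

lemma shd (q : ℤ) (c : Cell) (hc : c ∈ supp A) : d (shC m n q c) = d c + q * l := by
  induction q using Int.induction_on with
  | zero => simp [shC]
  | succ q ih =>
    rw [← tauC_shC, H.dper _ ((shC_mem H.per _ _).2 hc), ih]; ring
  | pred q ih =>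
    have := H.dper _ ((shC_mem H.per (-q - 1) _).2 hc)
    rw [tauC_shC, sub_add_cancel, ih] at this
    linarith

lemma mono {c c' : Cell} (hc : c ∈ supp A) (hc' : c' ∈ supp A) (h1 : c'.1 ≤ c.1) (h2 : c'.2 ≤ c.2) :
    d c' ≤ d c := by
  obtain ⟨p, hp, hpn, hpd⟩ := H.pred c' hc'
  have := H.lt c hc p hp ⟨hpn.1.trans_le h1, hpn.2.trans_le h2⟩
  omega

lemma down {c : Cell} (hc : c ∈ supp A) {k : ℤ} (hk : k ≤ d c) :
    ∃ p ∈ supp A, d p = k ∧ p.1 ≤ c.1 ∧ p.2 ≤ c.2 := by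
  induction k, hk using Int.leInductionDown with
  | base => exact ⟨c, hc, rfl, le_rfl, le_rfl⟩
  | pred k hk ih =>
    obtain ⟨p, hp, h1, h2, h3⟩ := ih
    obtain ⟨q, hq, h4, h5⟩ := H.pred p hp
    exact ⟨q, hq, by omega, h4.1.le.trans h2, h4.2.le.trans h3⟩

lemma exSE (x y N : ℤ) : ∃ c ∈ supp A, x < c.1 ∧ y < c.2 ∧ N ≤ d c := by
  obtain ⟨c, hc⟩ := H.ne
  have hm : (1 : ℤ) ≤ m := by exact_mod_cast H.hm
  have hn : (1 : ℤ) ≤ n := by exact_mod_cast H.hn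
  have hl : (1 : ℤ) ≤ l := by exact_mod_cast H.hl
  obtain ⟨q, hq⟩ : ∃ q, q = max 0 (max (x - c.1 + 1) (max (y - c.2 + 1) (N - d c))) := ⟨_, rfl⟩
  have h0 : 0 ≤ q ∧ x - c.1 + 1 ≤ q ∧ y - c.2 + 1 ≤ q ∧ N - d c ≤ q := by omega
  refine ⟨shC m n q c, (shC_mem H.per _ _).2 hc, ?_, ?_, ?_⟩
  · simp only [shC]; nlinarith
  · simp only [shC]; nlinarith
  · rw [H.shd _ _ hc]; nlinarith

lemma exNW (x y N : ℤ) : ∃ c ∈ supp A, c.1 < x ∧ c.2 < y ∧ d c ≤ N := by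
  obtain ⟨c, hc⟩ := H.ne
  have hm : (1 : ℤ) ≤ m := by exact_mod_cast H.hm
  have hn : (1 : ℤ) ≤ n := by exact_mod_cast H.hn
  have hl : (1 : ℤ) ≤ l := by exact_mod_cast H.hl
  obtain ⟨q, hq⟩ : ∃ q, q = max 0 (max (c.1 - x + 1) (max (c.2 - y + 1) (d c - N))) := ⟨_, rfl⟩
  have h0 : 0 ≤ q ∧ c.1 - x + 1 ≤ q ∧ c.2 - y + 1 ≤ q ∧ d c - N ≤ q := by omega
  refine ⟨shC m n (-q) c, (shC_mem H.per _ _).2 hc, ?_, ?_, ?_⟩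
  · simp only [shC]; nlinarith
  · simp only [shC]; nlinarith
  · rw [H.shd _ _ hc]; nlinarith

lemma level_ne (k : ℤ) : ∃ c ∈ supp A, d c = k := by
  obtain ⟨c, hc, -, -, h⟩ := H.exSE 0 0 k
  obtain ⟨p, hp, h1, -⟩ := H.down hc h
  exact ⟨p, hp, h1⟩

lemma level_fin (k : ℤ) : (levelSet A d k).Finite := by
  obtain ⟨F, hF, hFc⟩ := H.fin
  have hl : (0 : ℤ) < l := by exact_mod_cast H.hl
  refine (hF.image (fun c0 => shC m n ((k - d c0) / l) c0)).subset ?_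
  rintro c ⟨hc, hck⟩
  obtain ⟨c0, hc0, q, rfl⟩ := hFc c hc
  refine ⟨c0, hc0, ?_⟩
  have := H.shd q c0 ((shC_mem H.per _ _).1 hc)
  simp only
  rw [← hck, this, add_sub_cancel_left, Int.mul_ediv_cancel _ hl.ne']

end Num

/-- The greatest value of `d` weakly north-west of a cell. -/
def IsF (A : Mat) (d : Cell → ℤ) (f : ℤ → ℤ → ℤ) : Prop :=
  ∀ x y k, k ≤ f x y ↔ ∃ c ∈ supp A, c.1 ≤ x ∧ c.2 ≤ y ∧ d c = k

def IsBP (A : Mat) (d : Cell → ℤ) (k : ℤ) (c : Cell) : Prop :=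
  (∃ c' ∈ levelSet A d k, c'.1 = c.1) ∧ (∃ c' ∈ levelSet A d k, c'.2 = c.2) ∧
    ∀ c' ∈ levelSet A d k, c.1 ≤ c'.1 ∧ c.2 ≤ c'.2

namespace Num
variable {m n : ℕ} {A : Mat} {d : Cell → ℤ} {l : ℕ} (H : Num m n A d l)
include H

lemma exF : ∃ f, IsF A d f := by
  have : ∀ x y : ℤ, ∃ v : ℤ, ∀ k, k ≤ v ↔ ∃ c ∈ supp A, c.1 ≤ x ∧ c.2 ≤ y ∧ d c = k := by
    intro x y
    obtain ⟨c, hc, h1, h2, -⟩ := H.exSE x y 0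
    obtain ⟨c', hc', h1', h2', -⟩ := H.exNW x y 0
    obtain ⟨v, hv, hmax⟩ := Int.exists_greatest_of_bdd
      (P := fun k => ∃ c ∈ supp A, c.1 ≤ x ∧ c.2 ≤ y ∧ d c = k)
      ⟨d c, by
        rintro k ⟨p, hp, h3, h4, rfl⟩
        exact H.mono hc hp (by omega) (by omega)⟩
      ⟨d c', c', hc', h1'.le, h2'.le, rfl⟩
    refine ⟨v, fun k => ⟨fun hk => ?_, fun hk => hmax _ hk⟩⟩
    obtain ⟨p, hp, h3, h4, rfl⟩ := hv
    obtain ⟨q, hq, h5, h6, h7⟩ := H.down hp hk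
    exact ⟨q, hq, by omega, by omega, h5⟩
  choose f hf using this
  exact ⟨f, hf⟩

lemma f_mono {f} (hf : IsF A d f) {x y x' y' : ℤ} (h1 : x ≤ x') (h2 : y ≤ y') :
    f x y ≤ f x' y' := by
  obtain ⟨c, hc, h3, h4, h5⟩ := (hf x y _).1 le_rfl
  exact (hf x' y' _).2 ⟨c, hc, by omega, by omega, h5⟩

lemma f_step {f} (hf : IsF A d f) (x y : ℤ) : f x y ≤ f (x - 1) (y - 1) + 1 := by
  obtain ⟨c, hc, h3, h4, h5⟩ := (hf x y _).1 le_rfl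
  obtain ⟨p, hp, h6, h7⟩ := H.pred c hc
  have := (hf (x - 1) (y - 1) (d p)).2 ⟨p, hp, by have := h6.1; omega, by have := h6.2; omega, rfl⟩
  omega

lemma f_per {f} (hf : IsF A d f) (x y : ℤ) : f (x + m) (y + n) = f x y + l := by
  apply le_antisymm
  · obtain ⟨c, hc, h3, h4, h5⟩ := (hf (x + m) (y + n) _).1 le_rfl
    have := (hf x y (d (shC m n (-1) c))).2 ⟨shC m n (-1) c, (shC_mem H.per _ _).2 hc,
      by simp only [shC]; omega, by simp only [shC]; omega, rfl⟩
    rw [H.shd _ _ hc] at this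
    omega
  · obtain ⟨c, hc, h3, h4, h5⟩ := (hf x y _).1 le_rfl
    refine (hf _ _ _).2 ⟨tauC m n c, (H.per _).2 hc, ?_, ?_, ?_⟩
    · simp only [tauC]; omega
    · simp only [tauC]; omega
    · rw [H.dper _ hc, h5]

lemma bp_ex (k : ℤ) : ∃ c, IsBP A d k c := by
  obtain ⟨c0, hc0, hk⟩ := H.level_ne k
  have hne : (levelSet A d k).Nonempty := ⟨c0, hc0, hk⟩
  obtain ⟨a, ha, hamin⟩ := Set.exists_min_image _ Prod.fst (H.level_fin k) hne
  obtain ⟨b, hb, hbmin⟩ := Set.exists_min_image _ Prod.snd (H.level_fin k) hne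
  exact ⟨(a.1, b.2), ⟨a, ha, rfl⟩, ⟨b, hb, rfl⟩, fun c hc => ⟨hamin c hc, hbmin c hc⟩⟩

lemma nwMax_ex {k : ℤ} {c : Cell} (hc : c ∈ levelSet A d k) :
    ∃ c' ∈ nwMaximal (levelSet A d k), c'.1 ≤ c.1 ∧ c'.2 ≤ c.2 := by
  have hfin : ({c' ∈ levelSet A d k | nwGe c' c}).Finite := (H.level_fin k).subset (fun _ h => h.1)
  obtain ⟨a, ha, hmin⟩ := Set.exists_min_image _ (fun p : Cell => p.1 + p.2) hfin
    ⟨c, hc, le_rfl, le_rfl⟩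
  refine ⟨a, ⟨ha.1, fun c' hc' h => ?_⟩, ha.2.1, ha.2.2⟩
  have := hmin c' ⟨hc', h.1.trans ha.2.1, h.2.trans ha.2.2⟩
  have h1 := h.1
  have h2 := h.2
  exact Prod.ext (by omega) (by omega)

lemma zzV {f} (hf : IsF A d f) {k : ℤ} {z} (hz : ZigZagAt A d k z) (x y : ℤ) :
    VZ z x y ↔ k ≤ f x y := by
  rw [zz_V_iff hz.1, hz.2, hf]
  constructor
  · rintro ⟨c, hc, h⟩
    exact ⟨c, hc.1.1, h.1, h.2, hc.1.2⟩
  · rintro ⟨c, hc, h1, h2, h3⟩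
    obtain ⟨p, hp, h4, h5⟩ := H.nwMax_ex (k := k) ⟨hc, h3⟩
    exact ⟨p, hp, by omega, by omega⟩

lemma zz_ex (k : ℤ) : ∃ z, ZigZagAt A d k z := by
  obtain ⟨f, hf⟩ := H.exF
  obtain ⟨b, ⟨c1, h1, e1⟩, ⟨c2, h2, e2⟩, hmin⟩ := H.bp_ex k
  obtain ⟨z, hz, hV⟩ := zz_exists (fun x y => k ≤ f x y)
    (fun x y x' y' hx hy h => h.trans (H.f_mono hf hx hy)) b.1 c1.2 c2.1 b.2
    ((hf _ _ _).2 ⟨c1, h1.1, e1.le, le_rfl, h1.2⟩)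
    ((hf _ _ _).2 ⟨c2, h2.1, le_rfl, e2.le, h2.2⟩)
    (fun x y h => by
      obtain ⟨c, hc, h3, h4, h5⟩ := (hf _ _ _).1 h
      have := hmin c ⟨hc, h5⟩
      omega)
  refine ⟨z, hz, ?_⟩
  ext ⟨x, y⟩
  rw [zz_inner_iff hz, hV, hV, hV]
  constructor
  · rintro ⟨h3, h4, h5⟩
    obtain ⟨c, hc, h6, h7, h8⟩ := (hf _ _ _).1 h3
    have hcx : c.1 = x := by
      by_contra h; exact h4 ((hf _ _ _).2 ⟨c, hc, by omega, by omega, h8⟩)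
    have hcy : c.2 = y := by
      by_contra h; exact h5 ((hf _ _ _).2 ⟨c, hc, by omega, by omega, h8⟩)
    obtain rfl : c = (x, y) := Prod.ext hcx hcy
    refine ⟨⟨hc, h8⟩, fun p hp hpn => ?_⟩
    have h9 := hpn.1
    have h10 := hpn.2
    simp only at h9 h10
    apply Prod.ext
    · by_contra h; simp only at h
      exact h4 ((hf _ _ _).2 ⟨p, hp.1, by omega, by omega, hp.2⟩)
    · by_contra h; simp only at h
      exact h5 ((hf _ _ _).2 ⟨p, hp.1, by omega, by omega, hp.2⟩)
  · rintro ⟨⟨h3, h4⟩, h5⟩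
    refine ⟨(hf _ _ _).2 ⟨(x, y), h3, le_rfl, le_rfl, h4⟩, fun h => ?_, fun h => ?_⟩
    · obtain ⟨p, hp, h6, h7, h8⟩ := (hf _ _ _).1 h
      have := congrArg Prod.fst (h5 p ⟨hp, h8⟩ ⟨by simp only; omega, by simp only; omega⟩)
      simp only at this; omega
    · obtain ⟨p, hp, h6, h7, h8⟩ := (hf _ _ _).1 h
      have := congrArg Prod.snd (h5 p ⟨hp, h8⟩ ⟨by simp only; omega, by simp only; omega⟩)
      simp only at this; omega

lemma inner_iff {f} (hf : IsF A d f) (x y : ℤ) :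
    IsInnerOf A d (x, y) ↔ ∃ k, k ≤ f x y ∧ ¬ k ≤ f (x - 1) y ∧ ¬ k ≤ f x (y - 1) := by
  constructor
  · rintro ⟨k, z, hz, h⟩
    rw [zz_inner_iff hz.1, H.zzV hf hz, H.zzV hf hz, H.zzV hf hz] at h
    exact ⟨k, h⟩
  · rintro ⟨k, h⟩
    obtain ⟨z, hz⟩ := H.zz_ex k
    refine ⟨k, z, hz, ?_⟩
    rwa [zz_inner_iff hz.1, H.zzV hf hz, H.zzV hf hz, H.zzV hf hz]

lemma outer_iff {f} (hf : IsF A d f) (x y : ℤ) :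
    IsOuterOf A d (x, y) ↔
      ∃ k, k ≤ f (x - 1) y ∧ k ≤ f x (y - 1) ∧ ¬ k ≤ f (x - 1) (y - 1) := by
  constructor
  · rintro ⟨k, z, hz, h⟩
    rw [zz_outer_iff hz.1, H.zzV hf hz, H.zzV hf hz, H.zzV hf hz] at h
    exact ⟨k, h⟩
  · rintro ⟨k, h⟩
    obtain ⟨z, hz⟩ := H.zz_ex k
    refine ⟨k, z, hz, ?_⟩
    rwa [zz_outer_iff hz.1, H.zzV hf hz, H.zzV hf hz, H.zzV hf hz]

lemma inner_mem {f} (hf : IsF A d f) {x y k : ℤ} (h1 : k ≤ f x y) (h2 : ¬ k ≤ f (x - 1) y)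
    (h3 : ¬ k ≤ f x (y - 1)) : (x, y) ∈ supp A := by
  obtain ⟨c, hc, h6, h7, h8⟩ := (hf _ _ _).1 h1
  have hcx : c.1 = x := by
    by_contra h; exact h2 ((hf _ _ _).2 ⟨c, hc, by omega, by omega, h8⟩)
  have hcy : c.2 = y := by
    by_contra h; exact h3 ((hf _ _ _).2 ⟨c, hc, by omega, by omega, h8⟩)
  obtain rfl : c = (x, y) := Prod.ext hcx hcy
  exact hc

lemma flat_iff {f} (hf : IsF A d f) (A' : Mat) :
    FlatEntries A A' (IsInnerOf A d) (IsOuterOf A d) ↔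
      ∀ x y, (A' x y : ℤ) =
        A x y - (f x y - f (x - 1) y - f x (y - 1) + f (x - 1) (y - 1)) := by
  have key : ∀ x y, f (x - 1) (y - 1) ≤ f (x - 1) y ∧ f (x - 1) (y - 1) ≤ f x (y - 1) ∧
      f (x - 1) y ≤ f x y ∧ f x (y - 1) ≤ f x y ∧ f x y ≤ f (x - 1) (y - 1) + 1 := fun x y =>
    ⟨H.f_mono hf le_rfl (by omega), H.f_mono hf (by omega) le_rfl, H.f_mono hf (by omega) le_rfl,
      H.f_mono hf le_rfl (by omega), H.f_step hf x y⟩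
  constructor
  · intro hA x y
    obtain ⟨h1, h2, h3⟩ := hA (x, y)
    rw [H.inner_iff hf] at h1 h3
    rw [H.outer_iff hf] at h2 h3
    obtain ⟨k1, k2, k3, k4, k5⟩ := key x y
    simp only at h1 h2 h3
    by_cases hi : f x y = f (x - 1) (y - 1) + 1 ∧ f (x - 1) y = f (x - 1) (y - 1) ∧
        f x (y - 1) = f (x - 1) (y - 1)
    · have := h1 ⟨f x y, by omega, by omega, by omega⟩
      omega
    · by_cases ho : f (x - 1) y = f (x - 1) (y - 1) + 1 ∧ f x (y - 1) = f (x - 1) (y - 1) + 1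
      · have := h2 ⟨f x y, by omega, by omega, by omega⟩
        omega
      · have := h3 (by rintro ⟨k, hk⟩; omega) (by rintro ⟨k, hk⟩; omega)
        omega
  · rintro hA ⟨x, y⟩
    rw [H.inner_iff hf, H.outer_iff hf]
    have := hA x y
    obtain ⟨k1, k2, k3, k4, k5⟩ := key x y
    simp only
    refine ⟨?_, ?_, ?_⟩
    · rintro ⟨k, hk⟩; omega
    · rintro ⟨k, hk⟩; omega
    · intro g1 g2
      have g1' : ¬ (f x y = f (x - 1) (y - 1) + 1 ∧ f (x - 1) y = f (x - 1) (y - 1) ∧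
        f x (y - 1) = f (x - 1) (y - 1)) := fun hh => g1 ⟨f x y, by omega, by omega, by omega⟩
      have g2' : ¬ (f (x - 1) y = f (x - 1) (y - 1) + 1 ∧ f x (y - 1) = f (x - 1) (y - 1) + 1) :=
        fun hh => g2 ⟨f x y, by omega, by omega, by omega⟩
      omega

lemma bp_set (c : Cell) : c ∈ backPostSet A d ↔ ∃ k, IsBP A d k c := by
  constructor
  · rintro ⟨k, z, hz, cr, hcr, cl, hcl, h1, h2, rfl⟩
    rw [hz.2] at hcr hcl h1 h2
    refine ⟨k, ⟨cr, hcr.1, rfl⟩, ⟨cl, hcl.1, rfl⟩, fun c' hc' => ?_⟩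
    obtain ⟨p, hp, h3, h4⟩ := H.nwMax_ex hc'
    simp only
    refine ⟨?_, (h2 p hp).trans h4⟩
    by_contra h
    have := hcr.2 p hp.1 ⟨by omega, h1 p hp⟩
    subst this
    exact h h3
  · rintro ⟨k, ⟨c1, hc1, e1⟩, ⟨c2, hc2, e2⟩, hmin⟩
    obtain ⟨z, hz⟩ := H.zz_ex k
    have hfin : (nwMaximal (levelSet A d k)).Finite := (H.level_fin k).subset fun _ h => h.1
    obtain ⟨p, hp, h3, h4⟩ := H.nwMax_ex hc1
    obtain ⟨q, hq, h5, h6⟩ := H.nwMax_ex hc2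
    obtain ⟨cr, hcr, hcrm⟩ := Set.exists_max_image _ Prod.snd hfin ⟨p, hp⟩
    obtain ⟨cl, hcl, hclm⟩ := Set.exists_min_image _ Prod.snd hfin ⟨p, hp⟩
    refine ⟨k, z, hz, cr, by rwa [hz.2], cl, by rwa [hz.2], by rwa [hz.2], by rwa [hz.2], ?_⟩
    have g1 := hmin cr hcr.1
    have g2 := hmin cl hcl.1
    have g3 := hclm q hq
    apply Prod.ext
    · simp only
      by_contra h
      have := hcr.2 p hp.1 ⟨by omega, hcrm p hp⟩
      subst this
      omega
    · simp only; omega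

lemma bp_shift {k : ℤ} {c : Cell} (h : IsBP A d k c) : IsBP A d (k + l) (tauC m n c) := by
  obtain ⟨⟨c1, h1, e1⟩, ⟨c2, h2, e2⟩, hmin⟩ := h
  have mv : ∀ c ∈ levelSet A d k, tauC m n c ∈ levelSet A d (k + l) := fun c hc =>
    ⟨(H.per _).2 hc.1, by rw [H.dper _ hc.1, hc.2]⟩
  refine ⟨⟨_, mv c1 h1, by simp [tauC, e1]⟩, ⟨_, mv c2 h2, by simp [tauC, e2]⟩, fun c' hc' => ?_⟩
  have := hmin (shC m n (-1) c') ⟨(shC_mem H.per _ _).2 hc'.1, by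
    rw [H.shd _ _ hc'.1, hc'.2]; ring⟩
  simp only [shC, tauC] at this ⊢
  omega

lemma bp_unique {k : ℤ} {c c' : Cell} (h : IsBP A d k c) (h' : IsBP A d k c') : c = c' := by
  obtain ⟨⟨c1, h1, e1⟩, ⟨c2, h2, e2⟩, hmin⟩ := h
  obtain ⟨⟨c1', h1', e1'⟩, ⟨c2', h2', e2'⟩, hmin'⟩ := h'
  have := hmin _ h1'
  have := hmin _ h2'
  have := hmin' _ h1
  have := hmin' _ h2
  exact Prod.ext (by omega) (by omega)

lemma bp_lt {k : ℤ} {c c' : Cell} (h : IsBP A d k c) (h' : IsBP A d (k + 1) c') : NW c c' := by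
  obtain ⟨-, -, hmin⟩ := h
  obtain ⟨⟨c1', h1', e1'⟩, ⟨c2', h2', e2'⟩, -⟩ := h'
  obtain ⟨p, hp, hp1, hp2⟩ := H.pred c1' h1'.1
  obtain ⟨q, hq, hq1, hq2⟩ := H.pred c2' h2'.1
  have a1 := hmin p ⟨hp, by rw [hp2, h1'.2]; ring⟩
  have a2 := hmin q ⟨hq, by rw [hq2, h2'.2]; ring⟩
  have a3 := hp1.1
  have a4 := hq1.2
  exact ⟨by omega, by omega⟩

end Num

/-! ### Southwest numberings are periodic proper numberings, unique up to shift -/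

lemma NW.trans {a b c : Cell} (h : NW a b) (h' : NW b c) : NW a c :=
  ⟨h.1.trans h'.1, h.2.trans h'.2⟩

lemma enum_lt {e : ℤ → Cell} (he : ∀ i, NW (e i) (e (i + 1))) {i j : ℤ} (h : i < j) :
    NW (e i) (e j) := by
  have h' : i + 1 ≤ j := h
  induction j, h' using Int.leInduction with
  | base => exact he i
  | succ j hj ih => exact (ih (by omega)).trans (he j)

lemma enum_inj {e : ℤ → Cell} (he : ∀ i, NW (e i) (e (i + 1))) {i j : ℤ} (h : e i = e j) :
    i = j := by
  rcases lt_trichotomy i j with h1 | h1 | h1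
  · have := (enum_lt he h1).1; rw [h] at this; exact absurd this (lt_irrefl _)
  · exact h1
  · have := (enum_lt he h1).1; rw [h] at this; exact absurd this (lt_irrefl _)

lemma enum_shift {e e' : ℤ → Cell} (he : ∀ i, NW (e i) (e (i + 1)))
    (he' : ∀ i, NW (e' i) (e' (i + 1))) (hr : Set.range e = Set.range e') :
    ∃ c, ∀ i, e' i = e (i + c) := by
  have h1 : ∀ i, ∃ j, e j = e' i := fun i => by
    have : e' i ∈ Set.range e := by rw [hr]; exact ⟨i, rfl⟩
    exact this
  choose h hh using h1
  have hmono : StrictMono h := by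
    intro i j hij
    by_contra hc
    have h2 := enum_lt he' hij
    rw [← hh, ← hh] at h2
    rcases (not_lt.mp hc).lt_or_eq with h3 | h3
    · have := (enum_lt he h3).1; have := h2.1; omega
    · rw [h3] at h2; exact absurd h2.1 (lt_irrefl _)
  have hsurj : ∀ j, ∃ i, h i = j := fun j => by
    have : e j ∈ Set.range e' := by rw [← hr]; exact ⟨j, rfl⟩
    obtain ⟨i, hi⟩ := this
    exact ⟨i, enum_inj he (by rw [hh, hi])⟩
  have hs : ∀ i, h (i + 1) = h i + 1 := by
    intro i
    obtain ⟨j, hj⟩ := hsurj (h i + 1)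
    have a1 : i < j := hmono.lt_iff_lt.1 (by omega)
    have a2 : h (i + 1) ≤ h j := hmono.monotone (by omega)
    have a3 : h i < h (i + 1) := hmono (by omega)
    omega
  refine ⟨h 0, fun i => ?_⟩
  have : ∀ i, h i = i + h 0 := by
    intro i
    induction i using Int.induction_on with
    | zero => simp
    | succ q ih => rw [hs, ih]; ring
    | pred q ih => have := hs (-q - 1); rw [sub_add_cancel] at this; omega
  rw [← this, hh]

lemma sw_range {m n : ℕ} {A : Mat} {e e' : ℤ → Cell} (h : IsSWChannelEnum m n A e)
    (h' : IsSWChannelEnum m n A e') : Set.range e = Set.range e' := by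
  have key : ∀ {e e' : ℤ → Cell}, IsSWChannelEnum m n A e → IsSWChannelEnum m n A e' →
      Set.range e ⊆ Set.range e' := by
    rintro e e' ⟨⟨l, -, hl, -⟩, hc, hm⟩ ⟨-, hc', hm'⟩ c hce
    obtain ⟨-, c2, hc2, h2⟩ := hm _ hc' hce
    obtain ⟨-, c3, hc3, h3⟩ := hm' _ hc hc2
    obtain ⟨i, rfl⟩ := hce
    obtain ⟨j, rfl⟩ := hc3
    have a1 := h2.1
    have a2 := h2.2
    have a3 := h3.1
    have a4 := h3.2
    have : i = j := by
      rcases lt_trichotomy i j with h1 | h1 | h1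
      · have := (enum_lt hl h1).1; omega
      · exact h1
      · have := (enum_lt hl h1).2; omega
    subst this
    have : e i = c2 := Prod.ext (by omega) (by omega)
    rw [this]; exact hc2
  exact (key h h').antisymm (key h' h)

lemma sw_unique {m n : ℕ} {A : Mat} {d d' : Cell → ℤ} (h : IsSWNumbering m n A d)
    (h' : IsSWNumbering m n A d') : ∃ t, ∀ c ∈ supp A, d' c = d c + t := by
  obtain ⟨e, he, hd⟩ := h
  obtain ⟨e', he', hd'⟩ := h'
  obtain ⟨t, ht⟩ := enum_shift he.1.choose_spec.2.1 he'.1.choose_spec.2.1 (sw_range he he')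
  refine ⟨-t, fun c hc => ?_⟩
  apply le_antisymm
  · obtain ⟨k, ch, h1, h2, h3, idx, h4, h5⟩ := (hd' c hc).1
    have : d' c + t ∈ chainSet A e c :=
      ⟨k, ch, h1, h2, h3, idx + t, by rw [← ht, h4], by omega⟩
    have := (hd c hc).2 this
    omega
  · obtain ⟨k, ch, h1, h2, h3, idx, h4, h5⟩ := (hd c hc).1
    have : d c - t ∈ chainSet A e' c :=
      ⟨k, ch, h1, h2, h3, idx - t, by rw [ht, sub_add_cancel, h4], by omega⟩
    have := (hd' c hc).2 this
    omega

lemma flat_any {m n : ℕ} {A A' : Mat} {d : Cell → ℤ} (h : IsSWNumbering m n A d)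
    (hF : FlatRel m n A A') : FlatEntries A A' (IsInnerOf A d) (IsOuterOf A d) := by
  obtain ⟨d', hd', hE⟩ := hF
  obtain ⟨t, ht⟩ := sw_unique hd' h
  have hl : ∀ k, levelSet A d' k = levelSet A d (k + t) := by
    intro k
    ext c
    constructor
    · rintro ⟨h1, h2⟩; exact ⟨h1, by rw [ht c h1, h2]⟩
    · rintro ⟨h1, h2⟩; exact ⟨h1, by have := ht c h1; omega⟩
  have hz : ∀ k z, ZigZagAt A d' k z ↔ ZigZagAt A d (k + t) z := fun k z => by
    unfold ZigZagAt; rw [hl]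
  have h1 : IsInnerOf A d' = IsInnerOf A d := by
    ext c
    constructor
    · rintro ⟨k, z, h, h2⟩; exact ⟨k + t, z, (hz _ _).1 h, h2⟩
    · rintro ⟨k, z, h, h2⟩; exact ⟨k - t, z, (hz _ _).2 (by rwa [sub_add_cancel]), h2⟩
  have h2 : IsOuterOf A d' = IsOuterOf A d := by
    ext c
    constructor
    · rintro ⟨k, z, h, h2⟩; exact ⟨k + t, z, (hz _ _).1 h, h2⟩
    · rintro ⟨k, z, h, h2⟩; exact ⟨k - t, z, (hz _ _).2 (by rwa [sub_add_cancel]), h2⟩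
  rwa [h1, h2] at hE

lemma NW_shC {m n : ℕ} {q : ℤ} {a b : Cell} (h : NW a b) : NW (shC m n q a) (shC m n q b) :=
  ⟨by have := h.1; simp only [shC]; omega, by have := h.2; simp only [shC]; omega⟩

lemma chain_shift {m n : ℕ} {A : Mat} (hper : ∀ c, tauC m n c ∈ supp A ↔ c ∈ supp A)
    {e : ℤ → Cell} {l : ℕ} (he : ∀ (q i : ℤ), shC m n q (e i) = e (i + q * l)) (q : ℤ) {c : Cell}
    {v : ℤ} (hv : v ∈ chainSet A e c) : v + q * l ∈ chainSet A e (shC m n q c) := by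
  obtain ⟨k, ch, h1, h2, h3, idx, h4, h5⟩ := hv
  refine ⟨k, fun i => shC m n q (ch i), by simp only [h1], fun i hi => (shC_mem hper _ _).2 (h2 i hi),
    fun i hi => NW_shC (h3 i hi), idx + q * l, ?_, ?_⟩
  · rw [← he, h4]
  · rw [h5]; ring

lemma num_of_sw {m n : ℕ} {A : Mat} {d : Cell → ℤ} (hm : 0 < m) (hn : 0 < n)
    (hper : ∀ c, tauC m n c ∈ supp A ↔ c ∈ supp A)
    (hfin : ∃ F : Set Cell, F.Finite ∧ ∀ c ∈ supp A, ∃ c0 ∈ F, ∃ q : ℤ, c = shC m n q c0)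
    (h : IsSWNumbering m n A d) : ∃ l, Num m n A d l := by
  obtain ⟨e, ⟨⟨l, hl, he1, he2⟩, ⟨l', hs, hsub, -⟩, -⟩, hd⟩ := h
  have hsh : ∀ (q i : ℤ), shC m n q (e i) = e (i + q * l) := by
    intro q
    induction q using Int.induction_on with
    | zero => intro i; simp [shC]
    | succ q ih => intro i; rw [← tauC_shC, ih, he2]; congr 1; ring
    | pred q ih =>
      intro i
      have h1 := ih (i - l)
      have h2 := he2 (i - l)
      rw [sub_add_cancel] at h2
      rw [← h2] at *
      have h3 : shC m n (-q - 1) (tauC m n (e (i - l))) = shC m n (-q) (e (i - l)) := by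
        simp only [tauC, shC, Prod.mk.injEq]; constructor <;> ring
      rw [h3, h1]; congr 1; ring
  have hes : ∀ i, e i ∈ supp A := fun i => hsub ⟨i, rfl⟩
  have hlt : ∀ c₁ ∈ supp A, ∀ c₂ ∈ supp A, NW c₂ c₁ → d c₂ < d c₁ := by
    intro c₁ hc₁ c₂ hc₂ hN
    obtain ⟨k, ch, h1, h2, h3, idx, h4, h5⟩ := (hd c₂ hc₂).1
    have : d c₂ + 1 ∈ chainSet A e c₁ := by
      refine ⟨k + 1, fun i => if i = 0 then c₁ else ch (i - 1), by simp, ?_, ?_, idx, ?_, ?_⟩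
      · intro i hi
        by_cases h0 : i = 0
        · simp [h0, hc₁]
        · simp only [h0, if_false]; exact h2 _ (by omega)
      · intro i hi
        by_cases h0 : i = 0
        · subst h0; simpa [h1] using hN
        · simp only [h0, if_false]
          obtain ⟨j, rfl⟩ := Nat.exists_eq_succ_of_ne_zero h0
          simpa using h3 j (by omega)
      · simpa using h4
      · push_cast; omega
    have := (hd c₁ hc₁).2 this
    omega
  refine ⟨l, hm, hn, hl, ⟨e 0, hes 0⟩, hper, hfin, ?_, hlt, ?_⟩
  · intro c hc
    have hc' := (hper c).2 hc
    have ht : tauC m n c = shC m n 1 c := by simp [tauC, shC]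
    apply le_antisymm
    · have := chain_shift hper hsh (-1) (hd _ hc').1
      have h3 : shC m n (-1) (tauC m n c) = c := by
        simp [tauC, shC]
      rw [h3] at this
      have := (hd c hc).2 this
      omega
    · have := chain_shift hper hsh 1 (hd _ hc).1
      rw [← ht] at this
      have := (hd _ hc').2 this
      omega
  · intro c hc
    obtain ⟨k, ch, h1, h2, h3, idx, h4, h5⟩ := (hd c hc).1
    have hval : ∀ i, i ≤ d (e i) := fun i =>
      (hd _ (hes i)).2 ⟨0, fun _ => e i, rfl, fun _ _ => hes i, fun i hi => by omega, i, rfl, by simp⟩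
    rcases Nat.eq_zero_or_pos k with rfl | hk
    · have hce : c = e idx := by rw [h4, h1]
      have hN : NW (e (idx - 1)) c := by
        have := he1 (idx - 1); rwa [sub_add_cancel, ← hce] at this
      refine ⟨e (idx - 1), hes _, hN, ?_⟩
      have := hval (idx - 1)
      have := hlt c hc _ (hes _) hN
      push_cast at h5
      omega
    · have hN : NW (ch 1) c := by have := h3 0 hk; rwa [h1] at this
      have hm1 := h2 1 hk
      refine ⟨ch 1, hm1, hN, ?_⟩
      have a1 := hlt c hc _ hm1 hN
      have a2 := (hd _ hm1).2 ⟨k - 1, fun i => ch (i + 1), rfl, fun i hi => h2 _ (by omega),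
        fun i hi => h3 _ (by omega), idx, by simp only; rw [h4]; congr 1; omega, rfl⟩
      omega


/-! ### Blocks and the standardization relation -/

structure Blk (m K : ℕ) (E π : ℤ → ℤ) : Prop where
  gc : ∀ x i, x ≤ E i ↔ π x ≤ i
  perE : ∀ i, E (i + m) = E i + K

namespace Blk
variable {m K : ℕ} {E π : ℤ → ℤ} (h : Blk m K E π)
include h

lemma mono {x y : ℤ} (hxy : x ≤ y) : π x ≤ π y :=
  (h.gc _ _).1 (hxy.trans ((h.gc _ _).2 le_rfl))

lemma lt_of {x y : ℤ} (hxy : π x < π y) : x < y := by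
  by_contra hc
  have := h.mono (not_lt.mp hc); omega

lemma monoE {i j : ℤ} (hij : i ≤ j) : E i ≤ E j :=
  (h.gc _ _).2 (((h.gc _ _).1 le_rfl).trans hij)

lemma eq_iff (x i : ℤ) : π x = i ↔ x ∈ Finset.Ioc (E (i - 1)) (E i) := by
  rw [Finset.mem_Ioc, h.gc, ← not_le, h.gc]; omega

lemma perπ (x : ℤ) : π (x + K) = π x + m := by
  have h1 := (h.eq_iff x _).1 rfl
  rw [h.eq_iff]
  have := h.perE (π x)
  have h3 := h.perE (π x - 1)
  have e : π x - 1 + m = π x + m - 1 := by ring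
  rw [e] at h3
  rw [Finset.mem_Ioc] at h1 ⊢
  omega

end Blk

def ph (π σ : ℤ → ℤ) (b : Cell) : Cell := (π b.1, σ b.2)

structure Std (m n K : ℕ) (E π E' σ : ℤ → ℤ) (A B : Mat) : Prop where
  hm : 0 < m
  hn : 0 < n
  hK : 0 < K
  bE : Blk m K E π
  bE' : Blk n K E' σ
  perA : ∀ i j, A (i + m) (j + n) = A i j
  perB : ∀ i j, B (i + K) (j + K) = B i j
  le1 : ∀ i j, B i j ≤ 1
  row : ∀ b ∈ supp B, ∀ b' ∈ supp B, b.1 = b'.1 → b = b'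
  col : ∀ b ∈ supp B, ∀ b' ∈ supp B, b.2 = b'.2 → b = b'
  nw : ∀ b ∈ supp B, ∀ b' ∈ supp B, NW b b' → NW (ph π σ b) (ph π σ b')
  push : ∀ i j, A i j = ∑ k ∈ Finset.Ioc (E (i - 1)) (E i),
    ∑ l ∈ Finset.Ioc (E' (j - 1)) (E' j), B k l

namespace Std
variable {m n K : ℕ} {E π E' σ : ℤ → ℤ} {A B : Mat} (S : Std m n K E π E' σ A B)
include S

lemma mem_iff (c : Cell) : c ∈ supp A ↔ ∃ b ∈ supp B, ph π σ b = c := by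
  have : c ∈ supp A ↔ A c.1 c.2 ≠ 0 := Iff.rfl
  rw [this, S.push, Ne, Finset.sum_eq_zero_iff]
  simp only [Finset.sum_eq_zero_iff, not_forall]
  constructor
  · rintro ⟨k, hk, l, hl, h⟩
    exact ⟨(k, l), h, Prod.ext ((S.bE.eq_iff _ _).2 hk) ((S.bE'.eq_iff _ _).2 hl)⟩
  · rintro ⟨b, hb, rfl⟩
    exact ⟨b.1, (S.bE.eq_iff _ _).1 rfl, b.2, (S.bE'.eq_iff _ _).1 rfl, hb⟩

lemma ph_mem {b : Cell} (hb : b ∈ supp B) : ph π σ b ∈ supp A := (S.mem_iff _).2 ⟨b, hb, rfl⟩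

lemma nw' {b b' : Cell} (h : NW (ph π σ b) (ph π σ b')) : NW b b' :=
  ⟨S.bE.lt_of h.1, S.bE'.lt_of h.2⟩

lemma pA (c : Cell) : tauC m n c ∈ supp A ↔ c ∈ supp A := by
  show A _ _ ≠ 0 ↔ A _ _ ≠ 0
  simp only [tauC, S.perA]

lemma pB (c : Cell) : tauC K K c ∈ supp B ↔ c ∈ supp B := by
  show B _ _ ≠ 0 ↔ B _ _ ≠ 0
  simp only [tauC, S.perB]

lemma ph_tau (b : Cell) : ph π σ (tauC K K b) = tauC m n (ph π σ b) := by
  simp only [ph, tauC, S.bE.perπ, S.bE'.perπ]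

lemma ph_sh (q : ℤ) (b : Cell) : ph π σ (shC K K q b) = shC m n q (ph π σ b) := by
  induction q using Int.induction_on with
  | zero => simp [shC]
  | succ q ih => rw [← tauC_shC, S.ph_tau, ih, tauC_shC]
  | pred q ih =>
    have h1 : tauC K K (shC K K (-q - 1) b) = shC K K (-q) b := by rw [tauC_shC, sub_add_cancel]
    have h2 : tauC m n (shC m n (-q - 1) (ph π σ b)) = shC m n (-q) (ph π σ b) := by
      rw [tauC_shC, sub_add_cancel]
    rw [← h1, S.ph_tau, ← h2] at ih
    simp only [tauC, Prod.mk.injEq, add_left_inj] at ih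
    exact Prod.ext ih.1 ih.2

lemma finB : ∃ F : Set Cell, F.Finite ∧ ∀ c ∈ supp B, ∃ c0 ∈ F, ∃ q : ℤ, c = shC K K q c0 := by
  have hK : (0 : ℤ) < K := by exact_mod_cast S.hK
  refine ⟨{c ∈ supp B | c.2 ∈ Set.Ico (0 : ℤ) K}, ?_, ?_⟩
  · refine Set.Finite.of_finite_image (f := Prod.snd) ?_ ?_
    · exact (Set.finite_Ico (0 : ℤ) K).subset (by rintro _ ⟨c, hc, rfl⟩; exact hc.2)
    · intro a ha b hb hab
      exact S.col a ha.1 b hb.1 hab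
  · intro c hc
    refine ⟨shC K K (-(c.2 / K)) c, ⟨(shC_mem S.pB _ _).2 hc, ?_⟩, c.2 / K, ?_⟩
    · simp only [shC, Set.mem_Ico]
      have h1 := Int.emod_nonneg c.2 hK.ne'
      have h2 := Int.emod_lt_of_pos c.2 hK
      have h3 := Int.emod_add_mul_ediv c.2 K
      constructor <;> nlinarith
    · simp only [shC]; apply Prod.ext <;> simp

lemma finA : ∃ F : Set Cell, F.Finite ∧ ∀ c ∈ supp A, ∃ c0 ∈ F, ∃ q : ℤ, c = shC m n q c0 := by
  obtain ⟨F, hF, h⟩ := S.finB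
  refine ⟨ph π σ '' F, hF.image _, fun c hc => ?_⟩
  obtain ⟨b, hb, rfl⟩ := (S.mem_iff c).1 hc
  obtain ⟨b0, hb0, q, rfl⟩ := h b hb
  exact ⟨_, ⟨b0, hb0, rfl⟩, q, S.ph_sh _ _⟩

lemma numA {d} (h : IsSWNumbering m n A d) : ∃ l, Num m n A d l :=
  num_of_sw S.hm S.hn S.pA S.finA h

lemma numB {d} (h : IsSWNumbering K K B d) : ∃ l, Num K K B d l :=
  num_of_sw S.hK S.hK S.pB S.finB h

lemma lift_ex {c : Cell} (hc : c ∈ supp A) :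
    ∃ b ∈ supp B, ph π σ b = c ∧ ∀ b' ∈ supp B, ph π σ b' = c → neLe b b' := by
  have hfin : {b ∈ supp B | ph π σ b = c}.Finite := by
    refine Set.Finite.of_finite_image (f := Prod.fst) ?_ ?_
    · refine (Finset.finite_toSet (Finset.Ioc (E (c.1 - 1)) (E c.1))).subset ?_
      rintro _ ⟨b, hb, rfl⟩
      exact (S.bE.eq_iff _ _).1 (by rw [← hb.2]; rfl)
    · intro a ha b hb hab
      exact S.row a ha.1 b hb.1 hab
  obtain ⟨b0, hb0, h0⟩ := (S.mem_iff c).1 hc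
  obtain ⟨b, hb, hmax⟩ := Set.exists_max_image _ Prod.fst hfin ⟨b0, hb0, h0⟩
  refine ⟨b, hb.1, hb.2, fun b' hb' h => ⟨hmax b' ⟨hb', h⟩, ?_⟩⟩
  by_contra hc
  have h1 := hmax b' ⟨hb', h⟩
  rcases h1.lt_or_eq with h2 | h2
  · have := S.nw b' hb' b hb.1 ⟨h2, not_le.1 hc⟩
    rw [h, hb.2] at this
    exact absurd this.1 (lt_irrefl _)
  · have := S.row b' hb' b hb.1 h2
    subst this
    exact hc le_rfl

lemma exLift : ∃ L : Cell → Cell, (∀ c ∈ supp A, L c ∈ supp B ∧ ph π σ (L c) = c ∧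
      ∀ b' ∈ supp B, ph π σ b' = c → neLe (L c) b') ∧
      ∀ c ∈ supp A, L (tauC m n c) = tauC K K (L c) := by
  have : ∀ c, ∃ b, c ∈ supp A → b ∈ supp B ∧ ph π σ b = c ∧
      ∀ b' ∈ supp B, ph π σ b' = c → neLe b b' := by
    intro c
    by_cases hc : c ∈ supp A
    · obtain ⟨b, h⟩ := S.lift_ex hc
      exact ⟨b, fun _ => h⟩
    · exact ⟨c, fun h => absurd h hc⟩
  choose L hL using this
  refine ⟨L, hL, fun c hc => ?_⟩
  have hc' := (S.pA c).2 hc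
  obtain ⟨h1, h2, h3⟩ := hL c hc
  obtain ⟨h4, h5, h6⟩ := hL _ hc'
  have g1 := h6 (tauC K K (L c)) ((S.pB _).2 h1) (by rw [S.ph_tau, h2])
  have g2 := h3 (shC K K (-1) (L (tauC m n c))) ((shC_mem S.pB _ _).2 h4) (by
    rw [S.ph_sh, h5]; simp [shC, tauC])
  obtain ⟨a1, a2⟩ := g1
  obtain ⟨a3, a4⟩ := g2
  simp only [shC, tauC] at *
  exact Prod.ext (by simp only; omega) (by simp only; omega)

lemma pushStream {C : Set Cell} {l : ℕ} (h : IsStream K K C l) (hs : C ⊆ supp B) :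
    IsStream m n (ph π σ '' C) l := by
  obtain ⟨e, ⟨hl, h1, h2⟩, rfl⟩ := h
  refine ⟨fun i => ph π σ (e i), ⟨hl, fun i => S.nw _ (hs ⟨i, rfl⟩) _ (hs ⟨_, rfl⟩) (h1 i),
    fun i => ?_⟩, ?_⟩
  · rw [← S.ph_tau, h2]
  · rw [← Set.range_comp]; rfl

lemma liftEnum {L : Cell → Cell} (hL : ∀ c ∈ supp A, L c ∈ supp B ∧ ph π σ (L c) = c ∧
      ∀ b' ∈ supp B, ph π σ b' = c → neLe (L c) b')
      (hLt : ∀ c ∈ supp A, L (tauC m n c) = tauC K K (L c))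
      {e : ℤ → Cell} {l : ℕ} (h : IsStreamEnum m n e l) (hs : Set.range e ⊆ supp A) :
      IsStreamEnum K K (fun i => L (e i)) l := by
  obtain ⟨hl, h1, h2⟩ := h
  refine ⟨hl, fun i => S.nw' ?_, fun i => ?_⟩
  · rw [(hL _ (hs ⟨i, rfl⟩)).2.1, (hL _ (hs ⟨i + 1, rfl⟩)).2.1]
    exact h1 i
  · simp only
    rw [← hLt _ (hs ⟨i, rfl⟩), h2]

lemma sw {d : Cell → ℤ} (h : IsSWNumbering m n A d) :
    IsSWNumbering K K B (fun b => d (ph π σ b)) := by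
  obtain ⟨L, hL, hLt⟩ := S.exLift
  obtain ⟨e, ⟨⟨l, hel⟩, hch, hsw⟩, hd⟩ := h
  obtain ⟨l1, ⟨e1, he1, hr⟩, hsub, hmax⟩ := hch
  have hes : ∀ i, e i ∈ supp A := fun i => hsub ⟨i, rfl⟩
  have liftS : ∀ (C : Set Cell) (l' : ℕ), IsStream m n C l' → C ⊆ supp A →
      IsStream K K (L '' C) l' := by
    rintro C l' ⟨e', he', rfl⟩ hC
    exact ⟨fun i => L (e' i), S.liftEnum hL hLt he' hC, by rw [← Set.range_comp]; rfl⟩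
  have hrange : Set.range (fun i => L (e i)) = L '' Set.range e := by rw [← Set.range_comp]; rfl
  refine ⟨fun i => L (e i), ⟨⟨l, S.liftEnum hL hLt hel hsub⟩, ⟨l1, ?_, ?_, ?_⟩, ?_⟩, ?_⟩
  · rw [hrange]
    exact liftS _ _ ⟨e1, he1, hr⟩ hsub
  · rintro _ ⟨i, rfl⟩; exact (hL _ (hes i)).1
  · intro C l' hC hCs
    refine hmax _ l' (S.pushStream hC hCs) ?_
    rintro _ ⟨b, hb, rfl⟩
    exact S.ph_mem (hCs hb)
  · rintro C ⟨lB, hC, hCs, hCmax⟩ _ ⟨i, rfl⟩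
    have hchA : IsChannel m n A (ph π σ '' C) := by
      refine ⟨lB, S.pushStream hC hCs, ?_, ?_⟩
      · rintro _ ⟨b, hb, rfl⟩; exact S.ph_mem (hCs hb)
      · intro C' l' hC' hCs'
        refine hCmax _ l' (liftS _ _ hC' hCs') ?_
        rintro _ ⟨c, hc, rfl⟩; exact (hL _ (hCs' hc)).1
    obtain ⟨-, _, ⟨b', hb', rfl⟩, h1, h2⟩ := hsw _ hchA ⟨i, rfl⟩
    obtain ⟨g1, g2, g3⟩ := hL _ (hes i)
    refine ⟨g1, b', hb', ?_⟩
    have hb's := hCs hb'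
    by_cases heq : ph π σ b' = e i
    · exact g3 b' hb's heq
    · rw [← g2] at h1 h2 heq
      simp only [ph] at h1 h2 heq
      by_cases hne : L (e i) = b'
      · rw [hne] at heq; exact absurd rfl heq
      · have hr1 : (L (e i)).1 ≠ b'.1 := fun hh => hne (S.row _ g1 _ hb's hh)
        have hr2 : (L (e i)).2 ≠ b'.2 := fun hh => hne (S.col _ g1 _ hb's hh)
        have q1 : ¬ NW (L (e i)) b' := fun hh => by
          have := (S.nw _ g1 _ hb's hh).1; simp only [ph] at this; omega
        have q2 : ¬ NW b' (L (e i)) := fun hh => by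
          have := (S.nw _ hb's _ g1 hh).2; simp only [ph] at this; omega
        have q3 : ¬ ((L (e i)).1 < b'.1 ∧ b'.2 < (L (e i)).2) := by
          rintro ⟨p1, p2⟩
          have o1 := S.bE.mono p1.le
          have o2 := S.bE'.mono p2.le
          exact heq (Prod.ext (by simp only; omega) (by simp only; omega))
        simp only [NW] at q1 q2
        simp only [neLe]
        omega
  · intro b hb
    have hset : chainSet B (fun i => L (e i)) b = chainSet A e (ph π σ b) := by
      ext v
      constructor
      · rintro ⟨k, ch, h1, h2, h3, idx, h4, h5⟩
        refine ⟨k, fun i => ph π σ (ch i), by simp only [h1], fun i hi => S.ph_mem (h2 i hi),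
          fun i hi => S.nw _ (h2 _ (by omega)) _ (h2 _ (by omega)) (h3 i hi), idx, ?_, h5⟩
        simp only
        rw [← h4, (hL _ (hes idx)).2.1]
      · rintro ⟨k, ch, h1, h2, h3, idx, h4, h5⟩
        rcases Nat.eq_zero_or_pos k with rfl | hk
        · refine ⟨1, fun i => if i = 0 then b else L (e (idx - 1)), by simp, ?_, ?_, idx - 1, by simp,
            by push_cast at h5 ⊢; omega⟩
          · intro i hi
            by_cases h0 : i = 0
            · simp [h0, hb]
            · simp only [h0, if_false]; exact (hL _ (hes _)).1
          · intro i hi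
            obtain rfl : i = 0 := by omega
            simp only [zero_add, one_ne_zero, if_false, if_true]
            apply S.nw'
            rw [(hL _ (hes _)).2.1, ← h1, ← h4]
            have := hel.2.1 (idx - 1)
            rwa [sub_add_cancel] at this
        · have hph : ∀ i ≤ k, ph π σ (if i = 0 then b else L (ch i)) = ch i := by
            intro i hi
            by_cases h0 : i = 0
            · simp [h0, h1]
            · simp only [h0, if_false]; exact (hL _ (h2 i hi)).2.1
          refine ⟨k, fun i => if i = 0 then b else L (ch i), by simp, ?_, ?_, idx, ?_, h5⟩
          · intro i hi
            by_cases h0 : i = 0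
            · simp [h0, hb]
            · simp only [h0, if_false]; exact (hL _ (h2 i hi)).1
          · intro i hi
            apply S.nw'
            simp only
            rw [hph _ (by omega), hph _ (by omega)]
            exact h3 i hi
          · simp only [hk.ne', if_false]; rw [h4]
    rw [hset]
    exact hd _ (S.ph_mem hb)

end Std

/-! ### One step of the iteration -/

lemma tele (g : ℤ → ℤ) {a b : ℤ} (h : a ≤ b) :
    ∑ k ∈ Finset.Ioc a b, (g k - g (k - 1)) = g b - g a := by
  induction b, h using Int.leInduction with
  | base => simp
  | succ b hb ih =>
    have : Finset.Ioc a (b + 1) = insert (b + 1) (Finset.Ioc a b) := by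
      ext x; simp only [Finset.mem_Ioc, Finset.mem_insert]; omega
    rw [this, Finset.sum_insert (by simp), ih, add_sub_cancel_right]; ring

lemma tele2 (g : ℤ → ℤ → ℤ) {a b c d : ℤ} (h : a ≤ b) (h' : c ≤ d) :
    ∑ k ∈ Finset.Ioc a b, ∑ l ∈ Finset.Ioc c d,
      (g k l - g (k - 1) l - g k (l - 1) + g (k - 1) (l - 1)) = g b d - g a d - g b c + g a c := by
  have : ∀ k, ∑ l ∈ Finset.Ioc c d,
      (g k l - g (k - 1) l - g k (l - 1) + g (k - 1) (l - 1)) =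
        (g k d - g k c) - (g (k - 1) d - g (k - 1) c) := by
    intro k
    rw [← tele (g k) h', ← tele (g (k - 1)) h', ← Finset.sum_sub_distrib]
    exact Finset.sum_congr rfl fun _ _ => by ring
  simp only [this]
  rw [tele (fun k => g k d - g k c) h]; ring

def OutC (B : Mat) (d : Cell → ℤ) (k x y : ℤ) : Prop :=
  (∃ c ∈ levelSet B d k, c.1 = x ∧ c.2 < y) ∧ (∃ c ∈ levelSet B d k, c.2 = y ∧ c.1 < x) ∧
    ∀ p ∈ levelSet B d k, ¬ (p.1 < x ∧ p.2 < y)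

lemma outC_iff {B : Mat} {d : Cell → ℤ} {g} (hg : IsF B d g) (k x y : ℤ) :
    OutC B d k x y ↔ k ≤ g (x - 1) y ∧ k ≤ g x (y - 1) ∧ ¬ k ≤ g (x - 1) (y - 1) := by
  rw [hg, hg, hg]
  constructor
  · rintro ⟨⟨c, hc, h1, h2⟩, ⟨c', hc', h3, h4⟩, h⟩
    refine ⟨⟨c', hc'.1, by omega, by omega, hc'.2⟩, ⟨c, hc.1, by omega, by omega, hc.2⟩, ?_⟩
    rintro ⟨p, hp, h5, h6, h7⟩
    exact h p ⟨hp, h7⟩ (by omega)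
  · rintro ⟨⟨c', hc', h3, h4, h5⟩, ⟨c, hc, h6, h7, h8⟩, h⟩
    refine ⟨⟨c, ⟨hc, h8⟩, ?_, by omega⟩, ⟨c', ⟨hc', h5⟩, ?_, by omega⟩, ?_⟩
    · by_contra hh; exact h ⟨c, hc, by omega, by omega, h8⟩
    · by_contra hh; exact h ⟨c', hc', by omega, by omega, h5⟩
    · rintro p hp ⟨h9, h10⟩
      exact h ⟨p, hp.1, by omega, by omega, hp.2⟩

namespace Std
variable {m n K : ℕ} {E π E' σ : ℤ → ℤ} {A B : Mat} (S : Std m n K E π E' σ A B)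
include S

lemma gd {dB : Cell → ℤ} {lB : ℕ} (H : Num K K B dB lB) {g} (hg : IsF B dB g) (x y : ℤ) :
    (B x y : ℤ) - (g x y - g (x - 1) y - g x (y - 1) + g (x - 1) (y - 1)) =
      if ∃ k, OutC B dB k x y then 1 else 0 := by
  have m1 := H.f_mono hg (show x - 1 ≤ x by omega) (le_refl y)
  have m2 := H.f_mono hg (le_refl x) (show y - 1 ≤ y by omega)
  have m3 := H.f_mono hg (le_refl (x - 1)) (show y - 1 ≤ y by omega)
  have m4 := H.f_mono hg (show x - 1 ≤ x by omega) (le_refl (y - 1))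
  have m5 := H.f_step hg x y
  by_cases hB : B x y = 0
  · have hin : ¬ (g x y = g (x - 1) y + 1 ∧ g x y = g x (y - 1) + 1) := by
      rintro ⟨h1, h2⟩
      exact H.inner_mem hg (k := g x y) le_rfl (by omega) (by omega) hB
    split_ifs with h
    · obtain ⟨k, h⟩ := h
      rw [outC_iff hg] at h
      rw [hB]; push_cast; omega
    · have : ¬ (g (x - 1) (y - 1) + 1 ≤ g (x - 1) y ∧ g (x - 1) (y - 1) + 1 ≤ g x (y - 1)) := by
        rintro ⟨h1, h2⟩
        exact h ⟨_, (outC_iff hg _ _ _).2 ⟨h1, h2, by omega⟩⟩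
      rw [hB]; push_cast; omega
  · have hb : (x, y) ∈ supp B := hB
    have h0 : dB (x, y) ≤ g x y := (hg _ _ _).2 ⟨_, hb, le_rfl, le_rfl, rfl⟩
    have h1 : ¬ dB (x, y) ≤ g (x - 1) y := by
      rw [hg]
      rintro ⟨p, hp, q1, q2, q3⟩
      have : p.2 ≠ y := fun h => by
        have := S.col p hp _ hb h
        rw [this] at q1; simp only at q1; omega
      have := H.lt _ hb _ hp ⟨by simp only; omega, by simp only; omega⟩
      omega
    have h2 : ¬ dB (x, y) ≤ g x (y - 1) := by
      rw [hg]
      rintro ⟨p, hp, q1, q2, q3⟩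
      have : p.1 ≠ x := fun h => by
        have := S.row p hp _ hb h
        rw [this] at q2; simp only at q2; omega
      have := H.lt _ hb _ hp ⟨by simp only; omega, by simp only; omega⟩
      omega
    have hle := S.le1 x y
    rw [if_neg]
    · omega
    · rintro ⟨k, h⟩
      rw [outC_iff hg] at h
      omega

lemma flat_supp {dB : Cell → ℤ} {lB : ℕ} (H : Num K K B dB lB) {B' : Mat}
    (hF : FlatEntries B B' (IsInnerOf B dB) (IsOuterOf B dB)) (b : Cell) :
    b ∈ supp B' ↔ ∃ k, OutC B dB k b.1 b.2 := by
  obtain ⟨g, hg⟩ := H.exF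
  have h1 := (H.flat_iff hg B').1 hF b.1 b.2
  rw [S.gd H hg] at h1
  show B' b.1 b.2 ≠ 0 ↔ _
  split_ifs at h1 with h
  · simp only [h, iff_true]; omega
  · simp only [h, iff_false]; omega

lemma step {A' : Mat} (hF : FlatRel m n A A') :
    ∃ B', FlatRel K K B B' ∧ Std m n K E π E' σ A' B' := by
  obtain ⟨d, hd, hFE⟩ := hF
  obtain ⟨l, H⟩ := S.numA hd
  obtain ⟨lB, HB⟩ := S.numB (S.sw hd)
  set dB : Cell → ℤ := fun b => d (ph π σ b) with hdB
  obtain ⟨f, hf⟩ := H.exF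
  obtain ⟨g, hg⟩ := HB.exF
  have hfg : ∀ i j, f i j = g (E i) (E' j) := by
    intro i j
    have : ∀ k, k ≤ f i j ↔ k ≤ g (E i) (E' j) := by
      intro k
      rw [hf, hg]
      constructor
      · rintro ⟨c, hc, h1, h2, h3⟩
        obtain ⟨b, hb, rfl⟩ := (S.mem_iff c).1 hc
        exact ⟨b, hb, (S.bE.gc _ _).2 h1, (S.bE'.gc _ _).2 h2, h3⟩
      · rintro ⟨b, hb, h1, h2, h3⟩
        exact ⟨_, S.ph_mem hb, (S.bE.gc _ _).1 h1, (S.bE'.gc _ _).1 h2, h3⟩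
    exact le_antisymm ((this _).1 le_rfl) ((this _).2 le_rfl)
  have hA' := (H.flat_iff hf A').1 hFE
  let B' : Mat := fun x y =>
    ((B x y : ℤ) - (g x y - g (x - 1) y - g x (y - 1) + g (x - 1) (y - 1))).toNat
  have hB' : ∀ x y, (B' x y : ℤ) =
        B x y - (g x y - g (x - 1) y - g x (y - 1) + g (x - 1) (y - 1)) := by
    intro x y
    have := S.gd HB hg x y
    show ((Int.toNat _ : ℕ) : ℤ) = _
    rw [Int.toNat_of_nonneg]
    rw [this]; split_ifs <;> simp
  have hFB : FlatEntries B B' (IsInnerOf B dB) (IsOuterOf B dB) := (HB.flat_iff hg B').2 hB'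
  have hs := S.flat_supp HB hFB
  have hk : ∀ c ∈ supp B, ∀ c' ∈ supp B, c.1 = c'.1 ∨ c.2 = c'.2 → c = c' := fun c hc c' hc' h =>
    h.elim (S.row c hc c' hc') (S.col c hc c' hc')
  refine ⟨B', ⟨dB, S.sw hd, hFB⟩, S.hm, S.hn, S.hK, S.bE, S.bE', ?_, ?_, ?_, ?_, ?_, ?_, ?_⟩
  · intro i j
    have h1 := hA' i j
    have h2 := hA' (i + m) (j + n)
    rw [show i + (m : ℤ) - 1 = i - 1 + m by ring, show j + (n : ℤ) - 1 = j - 1 + n by ring,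
      H.f_per hf, H.f_per hf, H.f_per hf, H.f_per hf, S.perA] at h2
    omega
  · intro i j
    have h1 := hB' i j
    have h2 := hB' (i + K) (j + K)
    rw [show i + (K : ℤ) - 1 = i - 1 + K by ring, show j + (K : ℤ) - 1 = j - 1 + K by ring,
      HB.f_per hg, HB.f_per hg, HB.f_per hg, HB.f_per hg, S.perB] at h2
    omega
  · intro i j
    have h1 := hB' i j
    rw [S.gd HB hg] at h1
    split_ifs at h1 <;> omega
  · intro b hb b' hb' h
    obtain ⟨k, ⟨c, hc, h1, h2⟩, ⟨c2, hc2, h3, h4⟩, h5⟩ := (hs b).1 hb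
    obtain ⟨k', ⟨c', hc', h1', h2'⟩, ⟨c2', hc2', h3', h4'⟩, h5'⟩ := (hs b').1 hb'
    have := S.row c hc.1 c' hc'.1 (by omega)
    subst this
    have : k = k' := hc.2.symm.trans hc'.2
    subst this
    have a1 := h5 c2' hc2'
    have a2 := h5' c2 hc2
    exact Prod.ext h (by omega)
  · intro b hb b' hb' h
    obtain ⟨k, ⟨c, hc, h1, h2⟩, ⟨c2, hc2, h3, h4⟩, h5⟩ := (hs b).1 hb
    obtain ⟨k', ⟨c', hc', h1', h2'⟩, ⟨c2', hc2', h3', h4'⟩, h5'⟩ := (hs b').1 hb'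
    have := S.col c2 hc2.1 c2' hc2'.1 (by omega)
    subst this
    have : k = k' := hc2.2.symm.trans hc2'.2
    subst this
    have a1 := h5 c' hc'
    have a2 := h5' c hc
    exact Prod.ext (by omega) h
  · intro b hb b' hb' h
    obtain ⟨k, ⟨c, hc, h1, h2⟩, ⟨c2, hc2, h3, h4⟩, h5⟩ := (hs b).1 hb
    obtain ⟨k', ⟨c', hc', h1', h2'⟩, ⟨c2', hc2', h3', h4'⟩, h5'⟩ := (hs b').1 hb'
    obtain ⟨n1, n2⟩ := h
    constructor
    · show π b.1 < π b'.1
      refine lt_of_le_of_ne (S.bE.mono n1.le) fun heq => ?_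
      have g1 : c'.2 < c.2 := by
        by_contra hh
        have hne : c.2 ≠ c'.2 := fun e => by
          have := S.col c hc.1 c' hc'.1 e
          subst this; omega
        have := (S.nw c hc.1 c' hc'.1 ⟨by omega, by omega⟩).1
        simp only [ph, h1, h1'] at this
        omega
      have g2 := H.mono (S.ph_mem hc.1) (S.ph_mem hc'.1)
        (by simp only [ph, h1, h1']; omega) (S.bE'.mono g1.le)
      have g3 : k' ≤ dB c := by rw [← hc'.2]; exact g2
      obtain ⟨p, hp, p1, p2, p3⟩ := HB.down hc.1 g3
      exact h5' p ⟨hp, p1⟩ (by omega)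
    · show σ b.2 < σ b'.2
      refine lt_of_le_of_ne (S.bE'.mono n2.le) fun heq => ?_
      have g1 : c2'.1 < c2.1 := by
        by_contra hh
        have hne : c2.1 ≠ c2'.1 := fun e => by
          have := S.row c2 hc2.1 c2' hc2'.1 e
          subst this; omega
        have := (S.nw c2 hc2.1 c2' hc2'.1 ⟨by omega, by omega⟩).2
        simp only [ph, h3, h3'] at this
        omega
      have g2 := H.mono (S.ph_mem hc2.1) (S.ph_mem hc2'.1)
        (S.bE.mono g1.le) (by simp only [ph, h3, h3']; omega)
      have g3 : k' ≤ dB c2 := by rw [← hc2'.2]; exact g2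
      obtain ⟨p, hp, p1, p2, p3⟩ := HB.down hc2.1 g3
      exact h5' p ⟨hp, p1⟩ (by omega)
  · intro i j
    have : ((A' i j : ℕ) : ℤ) = ((∑ k ∈ Finset.Ioc (E (i - 1)) (E i),
      ∑ l ∈ Finset.Ioc (E' (j - 1)) (E' j), B' k l : ℕ) : ℤ) := by
      push_cast
      simp only [hB']
      simp only [Finset.sum_sub_distrib (f := fun l => ((B _ l : ℕ) : ℤ))]
      rw [Finset.sum_sub_distrib, tele2 g (S.bE.monoE (by omega)) (S.bE'.monoE (by omega)),
        hA', S.push i j, hfg, hfg, hfg, hfg]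
      push_cast
      rfl
    exact_mod_cast this

end Std

/-! ### Rows and columns removed at each step -/

namespace Std
variable {m n K : ℕ} {E π E' σ : ℤ → ℤ} {A B : Mat} (S : Std m n K E π E' σ A B)
include S

lemma row_iff {dB : Cell → ℤ} {lB : ℕ} (H : Num K K B dB lB) {B' : Mat}
    (hF : FlatEntries B B' (IsInnerOf B dB) (IsOuterOf B dB)) (x : ℤ) :
    (∃ b ∈ supp B', b.1 = x) ↔ (∃ b ∈ supp B, b.1 = x) ∧ ¬ ∃ k c, IsBP B dB k c ∧ c.1 = x := by
  constructor
  · rintro ⟨b, hb, rfl⟩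
    obtain ⟨k, ⟨c, hc, h1, h2⟩, ⟨c2, hc2, h3, h4⟩, h5⟩ := (S.flat_supp H hF b).1 hb
    refine ⟨⟨c, hc.1, h1⟩, ?_⟩
    rintro ⟨k', q, ⟨⟨p, hp, hpq⟩, -, hmin⟩, hq⟩
    have := S.row c hc.1 p hp.1 (by omega)
    subst this
    have : k = k' := hc.2.symm.trans hp.2
    subst this
    have := (hmin c2 hc2).1
    omega
  · rintro ⟨⟨b, hb, rfl⟩, hno⟩
    have hex : ∃ p ∈ levelSet B dB (dB b), p.1 < b.1 := by
      by_contra hh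
      push Not at hh
      obtain ⟨c, hc⟩ := H.bp_ex (dB b)
      refine hno ⟨_, c, hc, le_antisymm (hc.2.2 b ⟨hb, rfl⟩).1 ?_⟩
      obtain ⟨p, hp, e⟩ := hc.1
      rw [← e]; exact hh p hp
    obtain ⟨p0, hp0, hl0⟩ := hex
    obtain ⟨p, hp, hmin⟩ := Set.exists_min_image {p ∈ levelSet B dB (dB b) | p.1 < b.1} Prod.snd
      ((H.level_fin _).subset (Set.sep_subset _ _)) ⟨p0, hp0, hl0⟩
    refine ⟨(b.1, p.2), (S.flat_supp H hF _).2 ⟨dB b, ⟨b, ⟨hb, rfl⟩, rfl, ?_⟩, ⟨p, hp.1, rfl, hp.2⟩,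
      ?_⟩, rfl⟩
    · by_contra hh
      simp only at hh
      rcases (not_lt.1 hh).lt_or_eq with h | h
      · have := H.lt b hb p hp.1.1 ⟨hp.2, h⟩
        have := hp.1.2
        omega
      · have := S.col p hp.1.1 b hb h
        have := hp.2
        subst b
        omega
    · rintro q hq ⟨h1, h2⟩
      have := hmin q ⟨hq, h1⟩
      simp only at h2
      omega

lemma col_iff {dB : Cell → ℤ} {lB : ℕ} (H : Num K K B dB lB) {B' : Mat}
    (hF : FlatEntries B B' (IsInnerOf B dB) (IsOuterOf B dB)) (x : ℤ) :
    (∃ b ∈ supp B', b.2 = x) ↔ (∃ b ∈ supp B, b.2 = x) ∧ ¬ ∃ k c, IsBP B dB k c ∧ c.2 = x := by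
  constructor
  · rintro ⟨b, hb, rfl⟩
    obtain ⟨k, ⟨c, hc, h1, h2⟩, ⟨c2, hc2, h3, h4⟩, h5⟩ := (S.flat_supp H hF b).1 hb
    refine ⟨⟨c2, hc2.1, h3⟩, ?_⟩
    rintro ⟨k', q, ⟨-, ⟨p, hp, hpq⟩, hmin⟩, hq⟩
    have := S.col c2 hc2.1 p hp.1 (by omega)
    subst this
    have : k = k' := hc2.2.symm.trans hp.2
    subst this
    have := (hmin c hc).2
    omega
  · rintro ⟨⟨b, hb, rfl⟩, hno⟩
    have hex : ∃ p ∈ levelSet B dB (dB b), p.2 < b.2 := by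
      by_contra hh
      push Not at hh
      obtain ⟨c, hc⟩ := H.bp_ex (dB b)
      refine hno ⟨_, c, hc, le_antisymm (hc.2.2 b ⟨hb, rfl⟩).2 ?_⟩
      obtain ⟨p, hp, e⟩ := hc.2.1
      rw [← e]; exact hh p hp
    obtain ⟨p0, hp0, hl0⟩ := hex
    obtain ⟨p, hp, hmin⟩ := Set.exists_min_image {p ∈ levelSet B dB (dB b) | p.2 < b.2} Prod.fst
      ((H.level_fin _).subset (Set.sep_subset _ _)) ⟨p0, hp0, hl0⟩
    refine ⟨(p.1, b.2), (S.flat_supp H hF _).2 ⟨dB b, ⟨p, hp.1, rfl, hp.2⟩, ⟨b, ⟨hb, rfl⟩, rfl, ?_⟩,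
      ?_⟩, rfl⟩
    · by_contra hh
      simp only at hh
      rcases (not_lt.1 hh).lt_or_eq with h | h
      · have := H.lt b hb p hp.1.1 ⟨h, hp.2⟩
        have := hp.1.2
        omega
      · have := S.row p hp.1.1 b hb h
        have := hp.2
        subst b
        omega
    · rintro q hq ⟨h1, h2⟩
      have := hmin q ⟨hq, h2⟩
      simp only at h1
      omega

lemma bp_ph {d : Cell → ℤ} {k : ℤ} {c : Cell} (h : IsBP B (fun b => d (ph π σ b)) k c) :
    IsBP A d k (ph π σ c) := by
  obtain ⟨⟨p, hp, e1⟩, ⟨q, hq, e2⟩, hmin⟩ := h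
  refine ⟨⟨_, ⟨S.ph_mem hp.1, hp.2⟩, by simp only [ph, e1]⟩,
    ⟨_, ⟨S.ph_mem hq.1, hq.2⟩, by simp only [ph, e2]⟩, ?_⟩
  rintro c' ⟨hc', hd⟩
  obtain ⟨b, hb, rfl⟩ := (S.mem_iff c').1 hc'
  have := hmin b ⟨hb, hd⟩
  exact ⟨S.bE.mono this.1, S.bE'.mono this.2⟩

lemma row_min {d : Cell → ℤ} {l lB : ℕ} (H : Num m n A d l)
    (HB : Num K K B (fun b => d (ph π σ b)) lB) {k : ℤ} {c : Cell}
    (h : IsBP B (fun b => d (ph π σ b)) k c) {b : Cell} (hb : b ∈ supp B) (he : π b.1 = π c.1) :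
    c.1 ≤ b.1 := by
  by_contra hlt
  obtain ⟨⟨p, hp, e1⟩, -, hmin⟩ := h
  have h1 : p.2 ≤ b.2 := by
    by_contra hh
    have := (S.nw b hb p hp.1 ⟨by omega, by omega⟩).1
    simp only [ph, e1] at this; omega
  have h2 := H.mono (S.ph_mem hb) (S.ph_mem hp.1) (by simp only [ph, e1]; omega) (S.bE'.mono h1)
  have h3 : k ≤ (fun b => d (ph π σ b)) b := by rw [← hp.2]; exact h2
  obtain ⟨q, hq, q1, q2, q3⟩ := HB.down hb h3
  have := (hmin q ⟨hq, q1⟩).1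
  omega

lemma col_min {d : Cell → ℤ} {l lB : ℕ} (H : Num m n A d l)
    (HB : Num K K B (fun b => d (ph π σ b)) lB) {k : ℤ} {c : Cell}
    (h : IsBP B (fun b => d (ph π σ b)) k c) {b : Cell} (hb : b ∈ supp B) (he : σ b.2 = σ c.2) :
    c.2 ≤ b.2 := by
  by_contra hlt
  obtain ⟨-, ⟨p, hp, e1⟩, hmin⟩ := h
  have h1 : p.1 ≤ b.1 := by
    by_contra hh
    have := (S.nw b hb p hp.1 ⟨by omega, by omega⟩).2
    simp only [ph, e1] at this; omega
  have h2 := H.mono (S.ph_mem hb) (S.ph_mem hp.1) (S.bE.mono h1) (by simp only [ph, e1]; omega)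
  have h3 : k ≤ (fun b => d (ph π σ b)) b := by rw [← hp.2]; exact h2
  obtain ⟨q, hq, q1, q2, q3⟩ := HB.down hb h3
  have := (hmin q ⟨hq, q1⟩).2
  omega

end Std

/-! ### The tableau side -/

structure Tab (m K : ℕ) (E π : ℤ → ℤ) (s : ℕ) (μ : ℕ → ℕ) (P : ℕ → ℕ → ℤ)
    (R : ℕ → ℤ → Prop) (b : ℕ → ℤ → ℤ) (r : ℕ → ℤ) : Prop where
  blk : Blk m K E π
  E0 : E 0 = 0
  R0 : ∀ x, R 0 x
  Rs : ∀ x, ¬ R s x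
  mem : ∀ t < s, ∀ i, R t (b t i)
  succ : ∀ t < s, ∀ x, R (t + 1) x ↔ R t x ∧ ¬ ∃ i, b t i = x
  min : ∀ t < s, ∀ x i, R t x → π x = π (b t i) → b t i ≤ x
  smono : ∀ t < s, ∀ i j, i < j → π (b t i) < π (b t j)
  per : ∀ t < s, ∀ i, b t (i + μ t) = b t i + K
  pos : ∀ t < s, 0 < μ t
  ent : ∀ t < s, ∀ p : ℕ, p < μ t → P p t = π (b t (r t + 1 + p)) ∧ 1 ≤ P p t ∧ P p t ≤ m

namespace Tab
variable {m K : ℕ} {E π : ℤ → ℤ} {s : ℕ} {μ : ℕ → ℕ} {P : ℕ → ℕ → ℤ}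
    {R : ℕ → ℤ → Prop} {b : ℕ → ℤ → ℤ} {r : ℕ → ℤ} (T : Tab m K E π s μ P R b r)
include T

lemma inj {t : ℕ} (ht : t < s) {i j : ℤ} (h : π (b t i) = π (b t j)) : i = j := by
  rcases lt_trichotomy i j with h1 | h1 | h1
  · have := T.smono t ht _ _ h1; omega
  · exact h1
  · have := T.smono t ht _ _ h1; omega

lemma perq {t : ℕ} (ht : t < s) (q i : ℤ) : π (b t (i + q * μ t)) = π (b t i) + q * m := by
  induction q using Int.induction_on with
  | zero => simp
  | succ q ih =>
    rw [show i + ((q : ℤ) + 1) * μ t = (i + q * μ t) + μ t by ring, T.per t ht, T.blk.perπ, ih]; ring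
  | pred q ih =>
    have h := T.per t ht (i + (-(q : ℤ) - 1) * μ t)
    rw [show i + (-(q : ℤ) - 1) * μ t + μ t = i + -q * μ t by ring] at h
    rw [h, T.blk.perπ] at ih
    linarith

lemma occ {t : ℕ} (ht : t < s) {i : ℤ} (h1 : 1 ≤ i) (h2 : i ≤ m) :
    (∃ j, π (b t j) = i) ↔ ∃ x < μ t, P x t = i := by
  constructor
  · rintro ⟨j, hj⟩
    have hμ : (0 : ℤ) < μ t := by exact_mod_cast T.pos t ht
    set u := j - (r t + 1) with hu
    have e1 := Int.emod_nonneg u hμ.ne'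
    have e2 := Int.emod_lt_of_pos u hμ
    have e3 := Int.emod_add_mul_ediv u (μ t)
    set q := u / μ t with hq
    obtain ⟨p, hp⟩ := Int.eq_ofNat_of_zero_le e1
    rw [hp] at e2 e3
    have hp' : p < μ t := by exact_mod_cast e2
    obtain ⟨a1, a2, a3⟩ := T.ent t ht p hp'
    have e4 : j = (r t + 1 + p) + q * μ t := by linarith
    rw [e4, T.perq ht, ← a1] at hj
    have hq0 : q = 0 := by
      have g1 : q * m < 1 * m := by linarith
      have g2 : -1 * (m : ℤ) < q * m := by linarith
      have hm : (0 : ℤ) ≤ m := by positivity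
      have := lt_of_mul_lt_mul_right g1 hm
      have := lt_of_mul_lt_mul_right g2 hm
      omega
    exact ⟨p, hp', by rw [hq0] at hj; linarith⟩
  · rintro ⟨x, hx, rfl⟩
    exact ⟨_, (T.ent t ht x hx).1.symm⟩

lemma cnt_aux (μ : ℕ → ℕ) (P : ℕ → ℕ → ℤ) (t : ℕ) (i : ℤ) :
    ((Finset.range (t + 1)).filter (fun t' => ∃ x' < μ t', P x' t' = i)).card =
      ((Finset.range t).filter (fun t' => ∃ x' < μ t', P x' t' = i)).card +
        if ∃ x' < μ t, P x' t = i then 1 else 0 := by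
  rw [Finset.card_filter, Finset.card_filter, Finset.sum_range_succ]

lemma rem {t : ℕ} (ht : t ≤ s) {i : ℤ} (h1 : 1 ≤ i) (h2 : i ≤ m) :
    (∀ x, π x = i → (R t x ↔
      E (i - 1) + ((Finset.range t).filter (fun t' => ∃ x' < μ t', P x' t' = i)).card < x)) ∧
    E (i - 1) + ((Finset.range t).filter (fun t' => ∃ x' < μ t', P x' t' = i)).card ≤ E i ∧
    (t < s → ∀ j, π (b t j) = i → b t j =
      E (i - 1) + ((Finset.range t).filter (fun t' => ∃ x' < μ t', P x' t' = i)).card + 1) := by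
  have third : ∀ t c, t < s → (∀ x, π x = i → (R t x ↔ E (i - 1) + ((c : ℕ) : ℤ) < x)) →
      ∀ j, π (b t j) = i → b t j = E (i - 1) + (c : ℤ) + 1 ∧ E (i - 1) + (c : ℤ) + 1 ≤ E i := by
    intro t c ht hR j hj
    have g1 := (hR _ hj).1 (T.mem t ht j)
    have g2 := (T.blk.eq_iff _ _).1 hj
    rw [Finset.mem_Ioc] at g2
    have g3 : π (E (i - 1) + (c : ℤ) + 1) = i := by
      rw [T.blk.eq_iff, Finset.mem_Ioc]; omega
    have g4 := T.min t ht _ j ((hR _ g3).2 (by omega)) (g3.trans hj.symm)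
    omega
  suffices h : (∀ x, π x = i → (R t x ↔
      E (i - 1) + ((Finset.range t).filter (fun t' => ∃ x' < μ t', P x' t' = i)).card < x)) ∧
    E (i - 1) + ((Finset.range t).filter (fun t' => ∃ x' < μ t', P x' t' = i)).card ≤ E i from
    ⟨h.1, h.2, fun ht j hj => (third t _ ht h.1 j hj).1⟩
  induction t with
  | zero =>
    simp only [Finset.range_zero, Finset.filter_empty, Finset.card_empty, Nat.cast_zero, add_zero]
    refine ⟨fun x hx => ?_, T.blk.monoE (by omega)⟩
    have := (T.blk.eq_iff _ _).1 hx
    rw [Finset.mem_Ioc] at this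
    simp [T.R0, this.1]
  | succ t ih =>
    have ht' : t < s := ht
    obtain ⟨i1, i2⟩ := ih ht'.le
    have key := third t _ ht' i1
    rw [cnt_aux T]
    have ho := T.occ ht' h1 h2
    split_ifs with hc
    · obtain ⟨j, hj⟩ := ho.2 hc
      obtain ⟨k1, k2⟩ := key j hj
      push_cast
      refine ⟨fun x hx => ?_, by omega⟩
      rw [T.succ t ht', i1 x hx]
      have : (∃ i, b t i = x) ↔ x = b t j := by
        constructor
        · rintro ⟨j', rfl⟩; rw [T.inj ht' (hx.trans hj.symm)]
        · rintro rfl; exact ⟨_, rfl⟩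
      rw [this]
      omega
    · rw [← ho] at hc
      simp only [add_zero]
      refine ⟨fun x hx => ?_, i2⟩
      rw [T.succ t ht', i1 x hx]
      have : ¬ ∃ i, b t i = x := by
        rintro ⟨j, rfl⟩; exact hc ⟨j, hx⟩
      simp [this]

lemma total {i : ℤ} (h1 : 1 ≤ i) (h2 : i ≤ m) :
    E (i - 1) + ((Finset.range s).filter (fun t' => ∃ x' < μ t', P x' t' = i)).card = E i := by
  obtain ⟨g1, g2, -⟩ := T.rem le_rfl h1 h2
  by_contra hne
  have hlt := lt_of_le_of_ne g2 hne
  have : π (E i) = i := by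
    rw [T.blk.eq_iff, Finset.mem_Ioc]; omega
  exact T.Rs _ ((g1 _ this).2 hlt)

lemma below (i : ℕ) (hi : i ≤ m) :
    ((∑ t' ∈ Finset.range s, ((Finset.range (μ t')).filter (fun x' => P x' t' ≤ i)).card : ℕ) : ℤ)
      = E i := by
  induction i with
  | zero =>
    rw [Nat.cast_zero, T.E0, Nat.cast_eq_zero, Finset.sum_eq_zero_iff]
    intro t ht
    rw [Finset.card_eq_zero, Finset.filter_eq_empty_iff]
    intro x hx
    have := (T.ent t (Finset.mem_range.1 ht) x (Finset.mem_range.1 hx)).2.1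
    omega
  | succ i ih =>
    have ih := ih (by omega)
    have tot := T.total (i := (i : ℤ) + 1) (by omega) (by exact_mod_cast hi)
    rw [add_sub_cancel_right, ← ih, Finset.card_filter] at tot
    push_cast at tot ⊢
    rw [← tot, ← Finset.sum_add_distrib]
    refine Finset.sum_congr rfl fun t ht => ?_
    have ht := Finset.mem_range.1 ht
    have hsplit : (Finset.range (μ t)).filter (fun x' => P x' t ≤ (i : ℤ) + 1) =
        (Finset.range (μ t)).filter (fun x' => P x' t ≤ (i : ℤ)) ∪
          (Finset.range (μ t)).filter (fun x' => P x' t = (i : ℤ) + 1) := by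
      ext x
      simp only [Finset.mem_filter, Finset.mem_union]
      constructor
      · rintro ⟨a, b⟩
        rcases b.lt_or_eq with h | h
        · exact Or.inl ⟨a, by omega⟩
        · exact Or.inr ⟨a, h⟩
      · rintro (⟨a, b⟩ | ⟨a, b⟩) <;> exact ⟨a, by omega⟩
    rw [hsplit, Finset.card_union_of_disjoint]
    · push_cast
      congr 1
      split_ifs with h
      · obtain ⟨x, hx, he⟩ := h
        have : (Finset.range (μ t)).filter (fun x' => P x' t = (i : ℤ) + 1) = {x} := by
          ext y
          simp only [Finset.mem_filter, Finset.mem_range, Finset.mem_singleton]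
          constructor
          · rintro ⟨a1, a2⟩
            have e1 := (T.ent t ht y a1).1
            have e2 := (T.ent t ht x hx).1
            have := T.inj ht ((e1.symm.trans (a2.trans he.symm)).trans e2)
            omega
          · rintro rfl; exact ⟨hx, he⟩
        rw [this]; simp
      · rw [Nat.cast_eq_zero, Finset.card_eq_zero, Finset.filter_eq_empty_iff]
        intro x hx he
        exact h ⟨x, Finset.mem_range.1 hx, he⟩
    · rw [Finset.disjoint_filter]
      intro x _ h1 h2
      omega

lemma main {t : ℕ} (ht : t < s) {x : ℕ} (hx : x < μ t) :
    stdT s μ P x t = b t (r t + 1 + x) ∧ 1 ≤ stdT s μ P x t ∧ stdT s μ P x t ≤ K := by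
  obtain ⟨e1, e2, e3⟩ := T.ent t ht x hx
  obtain ⟨g1, g2, g3⟩ := T.rem ht.le e2 e3
  have g4 := g3 ht _ e1.symm
  obtain ⟨i, hi⟩ := Int.eq_ofNat_of_zero_le (show 0 ≤ P x t - 1 by omega)
  have hb := T.below i (by omega)
  have hstd : stdT s μ P x t = b t (r t + 1 + x) := by
    rw [g4, hi, ← hb]
    unfold stdT
    congr 3
    refine Finset.sum_congr rfl fun t' _ => ?_
    congr 1
    refine Finset.filter_congr fun y _ => ?_
    omega
  rw [hstd]
  have h0 := T.blk.monoE (show 0 ≤ P x t - 1 by omega)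
  have hm := T.blk.monoE e3
  have hEm := T.blk.perE 0
  have h5 := (T.blk.eq_iff _ _).1 e1.symm
  rw [Finset.mem_Ioc] at h5
  rw [zero_add, T.E0] at hEm
  rw [T.E0] at h0
  exact ⟨rfl, by omega, by omega⟩

end Tab

/-! ### Initial data -/

lemma decomp {m : ℕ} (hm : 0 < m) (i : ℤ) : ∃ (i0 : ℕ) (q : ℤ), 1 ≤ i0 ∧ i0 ≤ m ∧ i = i0 + q * m := by
  have hm' : (0 : ℤ) < m := by exact_mod_cast hm
  have e1 := Int.emod_nonneg (i - 1) hm'.ne'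
  have e2 := Int.emod_lt_of_pos (i - 1) hm'
  have e3 := Int.emod_add_mul_ediv (i - 1) m
  obtain ⟨p, hp⟩ := Int.eq_ofNat_of_zero_le e1
  refine ⟨p + 1, (i - 1) / m, by omega, by omega, ?_⟩
  push_cast
  rw [hp] at e3
  linarith

lemma psum_succ (α : ℕ → ℕ) (i : ℕ) : psum α (i + 1) = psum α i + α (i + 1) := by
  unfold psum
  rw [Finset.sum_Icc_succ_top (by omega)]

lemma blk_ex {m K : ℕ} (hm : 0 < m) (hK : 0 < K) {α : ℕ → ℕ} (hα : psum α m = K) :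
    ∃ E π : ℤ → ℤ, Blk m K E π ∧
      ∀ (i0 : ℕ) (q : ℤ), i0 ≤ m → E (i0 + q * m) = psum α i0 + q * K := by
  have hm' : (0 : ℤ) < m := by exact_mod_cast hm
  have hK' : (0 : ℤ) < K := by exact_mod_cast hK
  let E : ℤ → ℤ := fun i => psum α (i % m).toNat + (i / m) * K
  have hE0 : ∀ (i0 : ℕ) (q : ℤ), i0 < m → E (i0 + q * m) = psum α i0 + q * K := by
    intro i0 q h
    have h' : (i0 : ℤ) < m := by exact_mod_cast h
    simp only [E]
    rw [Int.add_mul_emod_self_right, Int.add_mul_ediv_right _ _ hm'.ne',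
      Int.emod_eq_of_lt (by omega) h', Int.ediv_eq_zero_of_lt (by omega) h']
    simp
  have hE : ∀ (i0 : ℕ) (q : ℤ), i0 ≤ m → E (i0 + q * m) = psum α i0 + q * K := by
    intro i0 q h
    rcases h.lt_or_eq with h | rfl
    · exact hE0 i0 q h
    · have := hE0 0 (q + 1) hm
      rw [show (i0 : ℤ) + q * i0 = ((0 : ℕ) : ℤ) + (q + 1) * i0 by push_cast; ring, this, hα]
      simp only [psum]
      push_cast
      simp
      ring
  have hper : ∀ i, E (i + m) = E i + K := by
    intro i
    simp only [E]
    have h := Int.add_mul_ediv_right i 1 hm'.ne'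
    rw [one_mul] at h
    rw [Int.add_emod_right, h]
    ring
  have hstep : ∀ i, E i ≤ E (i + 1) := by
    intro i
    obtain ⟨i0, q, h1, h2, h3⟩ := decomp hm (i + 1)
    have e2 := hE i0 q h2
    obtain ⟨j, rfl⟩ : ∃ j, i0 = j + 1 := ⟨i0 - 1, by omega⟩
    have e1 := hE j q (by omega)
    have h4 : i = j + q * m := by push_cast at h3; linarith
    rw [h3, e2, h4, e1, psum_succ]
    push_cast
    omega
  have hmono : Monotone E := monotone_int_of_le_succ hstep
  have hq : ∀ q : ℤ, E (q * m) = q * K := by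
    intro q
    have := hE 0 q (Nat.zero_le _)
    simpa [psum] using this
  have hex : ∀ x : ℤ, ∃ i, x ≤ E i ∧ ∀ z, x ≤ E z → i ≤ z := by
    intro x
    apply Int.exists_least_of_bdd
    · refine ⟨(-|x| - 1) * m, fun z hz => ?_⟩
      by_contra hlt
      have h1 := hmono (not_le.1 hlt).le
      rw [hq] at h1
      have := neg_abs_le x
      have : (-|x| - 1) * (K : ℤ) ≤ (-|x| - 1) * 1 := by
        apply mul_le_mul_of_nonpos_left <;> [omega; (have := abs_nonneg x; omega)]
      omega
    · refine ⟨|x| * m, ?_⟩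
      rw [hq]
      have h1 := le_abs_self x
      have : |x| * 1 ≤ |x| * (K : ℤ) := mul_le_mul_of_nonneg_left (by omega) (abs_nonneg x)
      omega
  choose π h1 h2 using hex
  exact ⟨E, π, ⟨fun x i => ⟨h2 x i, fun h => (h1 x).trans (hmono h)⟩, hper⟩, hE⟩

lemma perq_mat {K : ℕ} {B : Mat} (hper : ∀ i j, B (i + K) (j + K) = B i j) (q i j : ℤ) :
    B (i + q * K) (j + q * K) = B i j := by
  induction q using Int.induction_on with
  | zero => simp
  | succ q ih =>
    rw [show i + ((q : ℤ) + 1) * K = (i + q * K) + K by ring,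
      show j + ((q : ℤ) + 1) * K = (j + q * K) + K by ring, hper, ih]
  | pred q ih =>
    rw [← hper, show i + (-(q : ℤ) - 1) * K + K = i + -q * K by ring,
      show j + (-(q : ℤ) - 1) * K + K = j + -q * K by ring, ih]

lemma desc {m K : ℕ} (hm : 0 < m) {α : ℕ → ℕ} {E π : ℤ → ℤ} (bE : Blk m K E π)
    (hE : ∀ (i0 : ℕ) (q : ℤ), i0 ≤ m → E (i0 + q * m) = psum α i0 + q * K) {B : Mat}
    (hper : ∀ i j, B (i + K) (j + K) = B i j) (hu : ∀ i, ∃! j, B i j ≠ 0)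
    (hd : AlphaDescending m α B) {x y x' y' : ℤ} (h : B x y ≠ 0) (h' : B x' y' ≠ 0)
    (hlt : x < x') (he : π x = π x') : y' < y := by
  obtain ⟨i0, q, g1, g2, g3⟩ := decomp hm (π x)
  have hx := (bE.eq_iff _ _).1 (rfl : π x = π x)
  have hx' := (bE.eq_iff _ _).1 he.symm
  rw [Finset.mem_Ioc] at hx hx'
  have e1 : E (π x) = psum α i0 + q * K := by rw [g3, hE _ _ g2]
  have e2 : E (π x - 1) = psum α (i0 - 1) + q * K := by
    rw [← hE (i0 - 1) q (by omega), g3]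
    congr 1
    push_cast [g1]
    ring
  have hdes : ∀ z, E (π x - 1) < z → z < E (π x) → ∀ j j', B z j ≠ 0 → B (z + 1) j' ≠ 0 → j' < j := by
    intro z hz1 hz2 j j' hj hj'
    obtain ⟨a, a', ha, ha', hl⟩ := hd i0 g1 g2 (z - q * K) (by omega) (by omega)
    rw [← perq_mat hper q] at ha ha'
    rw [show z - q * K + q * K = z by ring] at ha
    rw [show z - q * K + 1 + q * K = z + 1 by ring] at ha'
    have := (hu z).unique hj ha
    have := (hu (z + 1)).unique hj' ha'
    omega
  have key : ∀ z, x + 1 ≤ z → z ≤ E (π x) → ∀ j, B z j ≠ 0 → j < y := by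
    intro z hz
    induction z, hz using Int.leInduction with
    | base => intro hz j hj; exact hdes x hx.1 (by omega) _ _ h hj
    | succ z hz ih =>
      intro hz' j hj
      obtain ⟨a, ha, -⟩ := hu z
      exact (hdes z (by omega) (by omega) _ _ ha hj).trans (ih (by omega) a ha)
  exact key x' hlt hx'.2 y' h'

lemma std_init {m n K : ℕ} (hm : 0 < m) (hn : 0 < n) (hK : 0 < K) {α β : ℕ → ℕ}
    {E π E' σ : ℤ → ℤ} (bE : Blk m K E π)
    (hE : ∀ (i0 : ℕ) (q : ℤ), i0 ≤ m → E (i0 + q * m) = psum α i0 + q * K)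
    (bE' : Blk n K E' σ)
    (hE' : ∀ (i0 : ℕ) (q : ℤ), i0 ≤ n → E' (i0 + q * n) = psum β i0 + q * K)
    {A B : Mat} (hA : IsGAP m n A) (hB : IsEAP K B) (hBd : IsABDescending m n α β B)
    (hAB : PermOf m n K α β A B) : Std m n K E π E' σ A B := by
  obtain ⟨⟨hp, -⟩, hle, hr, hc⟩ := hB
  refine ⟨hm, hn, hK, bE, bE', hA.1, hp, hle, ?_, ?_, ?_, ?_⟩
  · intro b hb b' hb' h
    refine Prod.ext h ((hr b.1).unique hb ?_)
    rw [h]; exact hb'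
  · intro b hb b' hb' h
    refine Prod.ext ((hc b.2).unique hb ?_) h
    rw [h]; exact hb'
  · rintro b hb b' hb' ⟨n1, n2⟩
    constructor
    · refine lt_of_le_of_ne (bE.mono n1.le) fun he => ?_
      have := desc hm bE hE hp hr hBd.1 hb hb' n1 he
      omega
    · refine lt_of_le_of_ne (bE'.mono n2.le) fun he => ?_
      have := desc (B := transM B) hn bE' hE' (fun i j => hp j i) hc hBd.2 (x := b.2) (y := b.1)
        hb hb' n2 he
      omega
  · intro i j
    obtain ⟨i0, q, g1, g2, rfl⟩ := decomp hm i
    obtain ⟨j0, r, g3, g4, rfl⟩ := decomp hn j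
    have e1 := hE (i0 - 1) q (by omega)
    have e2 := hE' (j0 - 1) r (by omega)
    push_cast [g1, g3] at e1 e2
    rw [hAB i0 j0 q r g1 g2 g3 g4, hE _ _ g2, hE' _ _ g4,
      show (i0 : ℤ) + q * m - 1 = i0 - 1 + q * m by ring,
      show (j0 : ℤ) + r * n - 1 = j0 - 1 + r * n by ring, e1, e2]
    have hI : ∀ a b : ℤ, Finset.Icc (a + 1) b = Finset.Ioc a b := by
      intro a b; ext x; simp only [Finset.mem_Icc, Finset.mem_Ioc]; omega
    simp only [hI]

lemma std_seq {m n K : ℕ} {E π E' σ : ℤ → ℤ} {B : Mat} (Aseq : ℕ → Mat)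
    (S : Std m n K E π E' σ (Aseq 0) B) (s : ℕ) (h : ∀ t < s, FlatRel m n (Aseq t) (Aseq (t + 1))) :
    ∃ Bseq : ℕ → Mat, Bseq 0 = B ∧ (∀ t ≤ s, Std m n K E π E' σ (Aseq t) (Bseq t)) ∧
      ∀ t < s, FlatRel K K (Bseq t) (Bseq (t + 1)) := by
  induction s with
  | zero =>
    refine ⟨fun _ => B, rfl, fun t ht => ?_, fun t ht => absurd ht (by omega)⟩
    obtain rfl : t = 0 := by omega
    exact S
  | succ s ih =>
    obtain ⟨Bs, h0, h1, h2⟩ := ih fun t ht => h t (by omega)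
    obtain ⟨B', h3, h4⟩ := (h1 s le_rfl).step (h s (by omega))
    refine ⟨Function.update Bs (s + 1) B', by simp [h0], fun t ht => ?_, fun t ht => ?_⟩
    · rcases Nat.lt_or_eq_of_le ht with h | rfl
      · rw [Function.update_of_ne (by omega)]; exact h1 t (by omega)
      · simpa using h4
    · rw [Function.update_of_ne (by omega)]
      rcases Nat.lt_or_eq_of_le (Nat.lt_succ_iff.1 ht) with h | rfl
      · rw [Function.update_of_ne (by omega)]; exact h2 t h
      · simpa using h3

lemma Std.streams {m n K : ℕ} {E π E' σ : ℤ → ℤ} {A B B' : Mat} (S : Std m n K E π E' σ A B)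
    {d : Cell → ℤ} {e : ℤ → Cell} {μ : ℕ} (hd : IsSWNumbering m n A d) (he : IsStreamEnum m n e μ)
    (hr : Set.range e = backPostSet A d) (hF : FlatRel K K B B') :
    ∃ (dB : Cell → ℤ) (eB : ℤ → Cell), IsSWNumbering K K B dB ∧ IsStreamEnum K K eB μ ∧
      Set.range eB = backPostSet B dB ∧ (∀ i, ph π σ (eB i) = e i) ∧
      ((∀ i, ∃ b ∈ supp B, b.1 = (eB i).1) ∧
        (∀ x, (∃ b ∈ supp B', b.1 = x) ↔ (∃ b ∈ supp B, b.1 = x) ∧ ¬ ∃ i, (eB i).1 = x) ∧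
        (∀ b ∈ supp B, ∀ i, π b.1 = π (eB i).1 → (eB i).1 ≤ b.1)) ∧
      ((∀ i, ∃ b ∈ supp B, b.2 = (eB i).2) ∧
        (∀ x, (∃ b ∈ supp B', b.2 = x) ↔ (∃ b ∈ supp B, b.2 = x) ∧ ¬ ∃ i, (eB i).2 = x) ∧
        (∀ b ∈ supp B, ∀ i, σ b.2 = σ (eB i).2 → (eB i).2 ≤ b.2)) := by
  obtain ⟨l, H⟩ := S.numA hd
  have hdB := S.sw hd
  obtain ⟨lB, HB⟩ := S.numB hdB
  have hFE := flat_any hdB hF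
  choose pA hpA using H.bp_ex
  choose pB hpB using HB.bp_ex
  have hph : ∀ k, ph π σ (pB k) = pA k := fun k => H.bp_unique (S.bp_ph (hpB k)) (hpA k)
  have ltA : ∀ i, NW (pA i) (pA (i + 1)) := fun i => H.bp_lt (hpA i) (hpA (i + 1))
  have ltB : ∀ i, NW (pB i) (pB (i + 1)) := fun i => HB.bp_lt (hpB i) (hpB (i + 1))
  have shA : ∀ i, tauC m n (pA i) = pA (i + l) := fun i => H.bp_unique (H.bp_shift (hpA i)) (hpA _)
  have shB : ∀ i, tauC K K (pB i) = pB (i + lB) :=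
    fun i => HB.bp_unique (HB.bp_shift (hpB i)) (hpB _)
  have hl : (lB : ℤ) = l := by
    have h1 : pA (0 + lB) = pA (0 + l) := by rw [← shA, ← hph, ← hph, ← shB, S.ph_tau]
    have := enum_inj ltA h1
    omega
  have hrA : Set.range pA = Set.range e := by
    rw [hr]
    ext c
    rw [H.bp_set]
    constructor
    · rintro ⟨k, rfl⟩; exact ⟨k, hpA k⟩
    · rintro ⟨k, h⟩; exact ⟨k, H.bp_unique (hpA k) h⟩
  obtain ⟨c, hc⟩ := enum_shift ltA he.2.1 hrA
  have hμ : (μ : ℤ) = l := by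
    have h1 : e (0 + μ) = e (0 + l) := by
      rw [← he.2.2, hc 0, shA, hc]; congr 1; ring
    have := enum_inj he.2.1 h1
    omega
  have hsurj : ∀ k, pB k = pB (k - c + c) := fun k => by rw [sub_add_cancel]
  refine ⟨_, fun i => pB (i + c), hdB, ⟨he.1, fun i => ?_, fun i => ?_⟩, ?_, fun i => ?_,
    ⟨fun i => ?_, fun x => ?_, fun b hb i h => ?_⟩, ⟨fun i => ?_, fun x => ?_, fun b hb i h => ?_⟩⟩
  · have := ltB (i + c)
    rwa [show i + c + 1 = i + 1 + c by ring] at this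
  · simp only
    rw [shB, hl, hμ]; congr 1; ring
  · ext p
    rw [HB.bp_set]
    constructor
    · rintro ⟨k, rfl⟩; exact ⟨_, hpB _⟩
    · rintro ⟨k, h⟩; exact ⟨k - c, by simp only; rw [← hsurj]; exact HB.bp_unique (hpB k) h⟩
  · simp only; rw [hph, hc]
  · obtain ⟨b, hb, h⟩ := (hpB (i + c)).1
    exact ⟨b, hb.1, h⟩
  · rw [S.row_iff HB hFE]
    refine and_congr_right fun _ => not_congr ⟨?_, ?_⟩
    · rintro ⟨k, p, h, rfl⟩
      refine ⟨k - c, ?_⟩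
      simp only; rw [← hsurj, HB.bp_unique (hpB k) h]
    · rintro ⟨i, rfl⟩; exact ⟨_, _, hpB _, rfl⟩
  · exact S.row_min H HB (hpB _) hb h
  · obtain ⟨b, hb, h⟩ := (hpB (i + c)).2.1
    exact ⟨b, hb.1, h⟩
  · rw [S.col_iff HB hFE]
    refine and_congr_right fun _ => not_congr ⟨?_, ?_⟩
    · rintro ⟨k, p, h, rfl⟩
      refine ⟨k - c, ?_⟩
      simp only; rw [← hsurj, HB.bp_unique (hpB k) h]
    · rintro ⟨i, rfl⟩; exact ⟨_, _, hpB _, rfl⟩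
  · exact S.col_min H HB (hpB _) hb h

lemma Std.zero {m n K : ℕ} {E π E' σ : ℤ → ℤ} {A B : Mat} (S : Std m n K E π E' σ A B) :
    A = 0 ↔ B = 0 := by
  constructor
  · rintro rfl
    funext x y
    by_contra h
    exact S.ph_mem (b := (x, y)) h rfl
  · rintro rfl
    funext x y
    rw [S.push]; simp


/-- Standardization is compatible with `κ₀`: if
`A ∈ M̂_{m×n}(α, β)` has standardization `A^perm = B ∈ W̃_{K,(α,β)}` and
`κ₀(A) = (P₀, Q₀, ρ)`, then `κ₀(B) = (P₀^st, Q₀^st, ρ)` (same shape `μ` and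
same `ρ`). -/
theorem kappa0_standardization (m n K : ℕ) (hm : 0 < m) (hn : 0 < n)
    (hK : 1 < K) (α β : ℕ → ℕ) (hα : psum α m = K) (hβ : psum β n = K)
    (A B : Mat) (hA : InMhatAB m n α β A)
    (hB : IsEAP K B) (hBd : IsABDescending m n α β B)
    (hAB : PermOf m n K α β A B)
    (s : ℕ) (μ : ℕ → ℕ) (P Q : ℕ → ℕ → ℤ) (ρ : ℕ → ℤ)
    (hκ : Kappa0Rel m n A s μ P Q ρ) :
    ∃ P' Q' : ℕ → ℕ → ℤ, Kappa0Rel K K B s μ P' Q' ρ ∧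
      ∀ t < s, ∀ x < μ t, P' x t = stdT s μ P x t ∧ Q' x t = stdT s μ Q x t := by
  have hK0 : 0 < K := by omega
  obtain ⟨E, π, bE, hE⟩ := blk_ex hm hK0 hα
  obtain ⟨E', σ, bE', hE'⟩ := blk_ex hn hK0 hβ
  have S := std_init hm hn hK0 bE hE bE' hE' hA.1 hB hBd hAB
  obtain ⟨Aseq, ⟨rfl, hne, hz, hflat⟩, hdat⟩ := hκ
  obtain ⟨Bseq, hB0, hS, hBflat⟩ := std_seq Aseq S s hflat
  have hE0 : E 0 = 0 := by
    have := hE 0 0 (Nat.zero_le _); simpa [psum] using this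
  have hE0' : E' 0 = 0 := by
    have := hE' 0 0 (Nat.zero_le _); simpa [psum] using this
  have hex : ∀ t, ∃ (dB : Cell → ℤ) (eB : ℤ → Cell) (r₁ r₂ : ℤ), t < s →
      (IsSWNumbering K K (Bseq t) dB ∧ IsStreamEnum K K eB (μ t) ∧
      Set.range eB = backPostSet (Bseq t) dB ∧
      ((∀ i, ∃ b ∈ supp (Bseq t), b.1 = (eB i).1) ∧
        (∀ x, (∃ b ∈ supp (Bseq (t + 1)), b.1 = x) ↔
          (∃ b ∈ supp (Bseq t), b.1 = x) ∧ ¬ ∃ i, (eB i).1 = x) ∧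
        (∀ b ∈ supp (Bseq t), ∀ i, π b.1 = π (eB i).1 → (eB i).1 ≤ b.1)) ∧
      ((∀ i, ∃ b ∈ supp (Bseq t), b.2 = (eB i).2) ∧
        (∀ x, (∃ b ∈ supp (Bseq (t + 1)), b.2 = x) ↔
          (∃ b ∈ supp (Bseq t), b.2 = x) ∧ ¬ ∃ i, (eB i).2 = x) ∧
        (∀ b ∈ supp (Bseq t), ∀ i, σ b.2 = σ (eB i).2 → (eB i).2 ≤ b.2))) ∧
      (∀ i, NW (ph π σ (eB i)) (ph π σ (eB (i + 1)))) ∧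
      (∀ p : ℕ, p < μ t → P p t = π (eB (r₁ + 1 + p)).1 ∧ 1 ≤ P p t ∧ P p t ≤ (m : ℤ)) ∧
      (∀ p : ℕ, p < μ t → Q p t = σ (eB (r₂ + 1 + p)).2 ∧ 1 ≤ Q p t ∧ Q p t ≤ (n : ℤ)) ∧
      ρ t = r₁ - r₂ := by
    intro t
    by_cases ht : t < s
    · obtain ⟨d, e, hd, he, hr, r₁, r₂, hp, hq, hρ⟩ := hdat t ht
      obtain ⟨dB, eB, h1, h2, h3, h4, h5, h6⟩ := (hS t ht.le).streams hd he hr (hBflat t ht)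
      refine ⟨dB, eB, r₁, r₂, fun _ => ⟨⟨h1, h2, h3, h5, h6⟩, ?_, ?_, ?_, hρ⟩⟩
      · intro i; rw [h4, h4]; exact he.2.1 i
      · intro p hp'
        have := hp p hp'
        rw [← h4] at this
        exact this
      · intro p hp'
        have := hq p hp'
        rw [← h4] at this
        exact this
    · exact ⟨fun _ => 0, fun _ => 0, 0, 0, fun h => absurd h ht⟩
  choose dB eB r₁ r₂ hall using hex
  have hBs : Bseq s = 0 := (hS s le_rfl).zero.1 hz
  have TP : Tab m K E π s μ P (fun t x => ∃ b ∈ supp (Bseq t), b.1 = x)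
      (fun t i => (eB t i).1) r₁ := by
    refine ⟨bE, hE0, ?_, ?_, ?_, ?_, ?_, ?_, ?_, ?_, ?_⟩
    · intro x
      obtain ⟨y, hy, -⟩ := hB.2.2.1 x
      refine ⟨(x, y), ?_, rfl⟩
      rw [hB0]; exact hy
    · rintro x ⟨b, hb, -⟩
      rw [hBs] at hb; exact hb rfl
    · intro t ht; exact (hall t ht).1.2.2.2.1.1
    · intro t ht; exact (hall t ht).1.2.2.2.1.2.1
    · rintro t ht x i ⟨b, hb, rfl⟩; exact (hall t ht).1.2.2.2.1.2.2 b hb i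
    · intro t ht i j hij
      exact (enum_lt (e := fun i => ph π σ (eB t i)) (hall t ht).2.1 hij).1
    · intro t ht i
      rw [← (hall t ht).1.2.1.2.2 i]; rfl
    · intro t ht; exact (hall t ht).1.2.1.1
    · intro t ht; exact (hall t ht).2.2.1
  have TQ : Tab n K E' σ s μ Q (fun t x => ∃ b ∈ supp (Bseq t), b.2 = x)
      (fun t i => (eB t i).2) r₂ := by
    refine ⟨bE', hE0', ?_, ?_, ?_, ?_, ?_, ?_, ?_, ?_, ?_⟩
    · intro y
      obtain ⟨x, hx, -⟩ := hB.2.2.2 y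
      refine ⟨(x, y), ?_, rfl⟩
      rw [hB0]; exact hx
    · rintro x ⟨b, hb, -⟩
      rw [hBs] at hb; exact hb rfl
    · intro t ht; exact (hall t ht).1.2.2.2.2.1
    · intro t ht; exact (hall t ht).1.2.2.2.2.2.1
    · rintro t ht x i ⟨b, hb, rfl⟩; exact (hall t ht).1.2.2.2.2.2.2 b hb i
    · intro t ht i j hij
      exact (enum_lt (e := fun i => ph π σ (eB t i)) (hall t ht).2.1 hij).2
    · intro t ht i
      rw [← (hall t ht).1.2.1.2.2 i]; rfl
    · intro t ht; exact (hall t ht).1.2.1.1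
    · intro t ht; exact (hall t ht).2.2.2.1
  refine ⟨stdT s μ P, stdT s μ Q, ⟨Bseq, ⟨hB0, fun t ht => ?_, hBs, hBflat⟩, fun t ht => ?_⟩,
    fun _ _ _ _ => ⟨rfl, rfl⟩⟩
  · rw [Ne, ← (hS t ht.le).zero]; exact hne t ht
  · refine ⟨dB t, eB t, (hall t ht).1.1, (hall t ht).1.2.1, (hall t ht).1.2.2.1, r₁ t, r₂ t,
      fun p hp => TP.main ht hp, fun p hp => TQ.main ht hp, (hall t ht).2.2.2.2⟩

end AffineRSK
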